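/- arXiv:1301.3374 — 3 statements merged into one kernel-verified Lean document; each statement's English description precedes it below -/
import Mathlib

section
/- Let Y be a real Banach space. If Y is universally right-stable, then Y is isomorphic to a Hilbert space, i.e. there exist a real Hilbert space H and a bounded linear bijection from Y onto H with bounded inverse. -/
open scoped ENNReal ZeroAtInfty

noncomputable section

/-- `f : X → Y` is a *standard ε-isometry*: `f 0 = 0` and
`|‖f x - f y‖ - ‖x - y‖| ≤ ε` for all `x, y`. -/
def StdEpsIsom {X Y : Type*} [NormedAddCommGroup X] [NormedAddCommGroup Y]
    (ε : ℝ) (f : X → Y) : Prop :=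
  f 0 = 0 ∧ ∀ x y : X, |‖f x - f y‖ - ‖x - y‖| ≤ ε

/-- `L(f)`: the closed linear span of the range of `f` in `Y`. -/
def Lf {X Y : Type*} [NormedAddCommGroup Y] [NormedSpace ℝ Y] (f : X → Y) :
    Submodule ℝ Y :=
  (Submodule.span ℝ (Set.range f)).topologicalClosure

theorem mem_Lf {X Y : Type*} [NormedAddCommGroup Y] [NormedSpace ℝ Y] (f : X → Y) (x : X) :
    f x ∈ Lf f :=
  Submodule.le_topologicalClosure _ (Submodule.subset_span ⟨x, rfl⟩)

/-- A standard ε-isometry `f` is *stable* if for some `α, γ > 0` there is a bounded linear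
operator `T : L(f) → X` with `‖T‖ ≤ α` such that `‖T (f x) - x‖ ≤ γ ε` for all `x`. -/
def IsStable {X Y : Type*} [NormedAddCommGroup X] [NormedSpace ℝ X]
    [NormedAddCommGroup Y] [NormedSpace ℝ Y] (ε : ℝ) (f : X → Y) : Prop :=
  ∃ α γ : ℝ, 0 < α ∧ 0 < γ ∧
    ∃ T : Lf f →L[ℝ] X, ‖T‖ ≤ α ∧ ∀ x : X, ‖T ⟨f x, mem_Lf f x⟩ - x‖ ≤ γ * ε

/-- The pair `(X, Y)` is *stable* if every standard ε-isometry `f : X → Y` (ε > 0) is stable. -/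
def PairStable (X Y : Type*) [NormedAddCommGroup X] [NormedSpace ℝ X]
    [NormedAddCommGroup Y] [NormedSpace ℝ Y] : Prop :=
  ∀ ε : ℝ, 0 < ε → ∀ f : X → Y, StdEpsIsom ε f → IsStable ε f

universe u

open MeasureTheory ProbabilityTheory Filter Topology

abbrev EU (n : ℕ) := EuclideanSpace ℝ (Fin n)

lemma pi_gauss_ac (n : ℕ) : Measure.pi (fun _ : Fin n => gaussianReal 0 1) ≪
    Measure.pi (fun _ : Fin n => (volume : Measure ℝ)) := by
  induction n with
  | zero =>
    rw [Measure.pi_of_empty, Measure.pi_of_empty]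
  | succ n ih =>
    have h1 := (measurePreserving_piFinSuccAbove (fun _ : Fin (n+1) => gaussianReal 0 1) 0).symm
    have h2 := (measurePreserving_piFinSuccAbove (fun _ : Fin (n+1) => (volume : Measure ℝ)) 0).symm
    rw [← h1.map_eq, ← h2.map_eq]
    exact ((gaussianReal_absolutelyContinuous 0 one_ne_zero).prod ih).map h1.measurable

lemma gauss_ac (n : ℕ) : stdGaussian (EU n) ≪ (volume : Measure (EU n)) := by
  rw [← map_pi_eq_stdGaussian, ← (PiLp.volume_preserving_toLp (Fin n)).map_eq]
  exact (pi_gauss_ac n).map (PiLp.volume_preserving_toLp (Fin n)).measurable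

lemma gauss_fderiv_bound {n : ℕ} {F : EU n → ℝ} (hF : LipschitzWith 1 F)
    (hI : Integrable (fun p : EU n × EU n => (fderiv ℝ F p.1 p.2) ^ 2)
      ((stdGaussian (EU n)).prod (stdGaussian (EU n)))) :
    ∫ p : EU n × EU n, (fderiv ℝ F p.1 p.2) ^ 2
      ∂((stdGaussian (EU n)).prod (stdGaussian (EU n))) ≤ 1 := by
  rw [integral_prod _ hI]
  have : ∀ x, ∫ y, (fderiv ℝ F x y) ^ 2 ∂(stdGaussian (EU n)) = ‖fderiv ℝ F x‖ ^ 2 := by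
    intro x
    rw [← variance_dual_stdGaussian, variance_of_integral_eq_zero]
    · exact (ContinuousLinearMap.continuous _).aemeasurable
    · exact integral_strongDual_stdGaussian _
  simp only [this]
  have hle : ∀ x, ‖fderiv ℝ F x‖ ^ 2 ≤ 1 := by
    intro x
    have := norm_fderiv_le_of_lipschitz ℝ (x₀ := x) hF
    simp at this
    exact pow_le_one₀ (norm_nonneg _) this
  calc ∫ x, ‖fderiv ℝ F x‖ ^ 2 ∂(stdGaussian (EU n)) ≤ ∫ x, (1 : ℝ) ∂(stdGaussian (EU n)) := by
        apply integral_mono_of_nonneg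
        · exact Eventually.of_forall fun x => by positivity
        · exact integrable_const _
        · exact Eventually.of_forall hle
    _ = 1 := by simp

lemma rot_comp {E : Type*} [NormedAddCommGroup E] [NormedSpace ℝ E] (a b : ℝ) (p : E × E) :
    ContinuousLinearMap.rotation a (ContinuousLinearMap.rotation b p)
      = ContinuousLinearMap.rotation (a + b) p := by
  simp only [ContinuousLinearMap.rotation_apply, Real.cos_add, Real.sin_add]
  ext1 <;> simp only <;> module

lemma rot_lip {n : ℕ} {F : EU n → ℝ} (hF : LipschitzWith 1 F) (δ : ℝ) (p : EU n × EU n) :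
    |F (ContinuousLinearMap.rotation δ p).1 - F p.1| ≤ |δ| * (2 * ‖p‖) := by
  have h1 := hF.dist_le_mul (ContinuousLinearMap.rotation δ p).1 p.1
  rw [Real.dist_eq] at h1
  refine h1.trans ?_
  rw [dist_eq_norm, ContinuousLinearMap.rotation_apply]
  have : Real.cos δ • p.1 + Real.sin δ • p.2 - p.1 = (Real.cos δ - 1) • p.1 + Real.sin δ • p.2 := by
    module
  simp only [this]
  have hc : |Real.cos δ - 1| ≤ |δ| := by
    have := Real.abs_cos_sub_cos_le δ 0
    simpa using this
  have hs : |Real.sin δ| ≤ |δ| := Real.abs_sin_le_abs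
  have h2 : ‖(Real.cos δ - 1) • p.1 + Real.sin δ • p.2‖ ≤ |δ| * ‖p‖ + |δ| * ‖p‖ := by
    refine (norm_add_le _ _).trans ?_
    rw [norm_smul, norm_smul, Real.norm_eq_abs, Real.norm_eq_abs]
    gcongr
    · exact norm_fst_le p
    · exact norm_snd_le p
  simp only [NNReal.coe_one, one_mul]
  linarith

lemma gauss_prod_sq_int (n : ℕ) : Integrable (fun p : EU n × EU n => (2 * ‖p‖) ^ 2)
    ((stdGaussian (EU n)).prod (stdGaussian (EU n))) := by
  have := (IsGaussian.memLp_id ((stdGaussian (EU n)).prod (stdGaussian (EU n))) 2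
    (by norm_num)).integrable_norm_pow (p := 2) (by norm_num)
  simp only [mul_pow]
  exact this.const_mul _

lemma gauss_step_int {n : ℕ} {F : EU n → ℝ} (hF : LipschitzWith 1 F) (δ : ℝ) :
    Integrable (fun p : EU n × EU n => (F (ContinuousLinearMap.rotation δ p).1 - F p.1) ^ 2)
    ((stdGaussian (EU n)).prod (stdGaussian (EU n))) := by
  have hc := hF.continuous
  refine ((gauss_prod_sq_int n).const_mul (|δ| ^ 2)).mono' ?_ ?_
  · have : Continuous (fun p : EU n × EU n => (F (ContinuousLinearMap.rotation δ p).1 - F p.1) ^ 2) := by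
      fun_prop
    exact this.aestronglyMeasurable
  · refine Eventually.of_forall fun p => ?_
    rw [Real.norm_eq_abs, abs_pow, ← mul_pow]
    exact pow_le_pow_left₀ (abs_nonneg _) (rot_lip hF δ p) 2

lemma gauss_step {n : ℕ} {F : EU n → ℝ} (hF : LipschitzWith 1 F) (m : ℕ) :
    ∫ p : EU n × EU n, (F p.2 - F p.1) ^ 2 ∂((stdGaussian (EU n)).prod (stdGaussian (EU n))) ≤
    ((m + 1 : ℕ) : ℝ) ^ 2 * ∫ p : EU n × EU n,
      (F (ContinuousLinearMap.rotation (Real.pi / 2 / ((m + 1 : ℕ) : ℝ)) p).1 - F p.1) ^ 2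
      ∂((stdGaussian (EU n)).prod (stdGaussian (EU n))) := by
  set γ := (stdGaussian (EU n)).prod (stdGaussian (EU n)) with hγ
  set δ : ℝ := Real.pi / 2 / ((m + 1 : ℕ) : ℝ) with hδ
  have hrot : ∀ θ, MeasurePreserving (ContinuousLinearMap.rotation (E := EU n) θ) γ γ := by
    intro θ
    refine ⟨(ContinuousLinearMap.continuous _).measurable, ?_⟩
    exact IsGaussian.map_rotation_eq_self (by simp) θ
  let g : ℕ → EU n × EU n → ℝ := fun k p => F (ContinuousLinearMap.rotation ((k : ℝ) * δ) p).1
  let G : EU n × EU n → ℝ := fun p => (F (ContinuousLinearMap.rotation δ p).1 - F p.1) ^ 2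
  have hGint : Integrable G γ := gauss_step_int hF δ
  have hgG : ∀ k p, (g (k+1) p - g k p) ^ 2 = G (ContinuousLinearMap.rotation ((k : ℝ) * δ) p) := by
    intro k p
    simp only [g, G, rot_comp]
    have : ((k + 1 : ℕ) : ℝ) * δ = δ + k * δ := by push_cast; ring
    rw [this]
  have hGk : ∀ k : ℕ, Integrable (fun p => (g (k+1) p - g k p) ^ 2) γ := by
    intro k
    simp only [hgG]
    exact (hrot _).integrable_comp_of_integrable hGint
  have hGi : ∀ k : ℕ, ∫ p, (g (k+1) p - g k p) ^ 2 ∂γ = ∫ p, G p ∂γ := by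
    intro k
    simp only [hgG]
    have h1 := integral_map (μ := γ) (hrot (k * δ)).measurable.aemeasurable
      (f := G) (by rw [(hrot _).map_eq]; exact hGint.aestronglyMeasurable)
    rw [(hrot _).map_eq] at h1
    exact h1.symm
  have htel : ∀ p : EU n × EU n, (F p.2 - F p.1) ^ 2 ≤
      ((m + 1 : ℕ) : ℝ) * ∑ k ∈ Finset.range (m + 1), (g (k+1) p - g k p) ^ 2 := by
    intro p
    have h1 : F p.2 - F p.1 = ∑ k ∈ Finset.range (m + 1), (g (k+1) p - g k p) := by
      rw [Finset.sum_range_sub (fun k => g k p)]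
      have h2 : ((m + 1 : ℕ) : ℝ) * δ = Real.pi / 2 := by
        rw [hδ]; field_simp
      simp [g, h2, ContinuousLinearMap.rotation_apply, -Nat.cast_add]
    rw [h1]
    have := sq_sum_le_card_mul_sum_sq (s := Finset.range (m + 1)) (f := fun k => g (k+1) p - g k p)
    simpa using this
  have hint2 : Integrable (fun p => ((m + 1 : ℕ) : ℝ) *
      ∑ k ∈ Finset.range (m + 1), (g (k+1) p - g k p) ^ 2) γ :=
    (integrable_finsetSum _ fun k _ => hGk k).const_mul _
  calc ∫ p : EU n × EU n, (F p.2 - F p.1) ^ 2 ∂γ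
      ≤ ∫ p, ((m + 1 : ℕ) : ℝ) * ∑ k ∈ Finset.range (m + 1), (g (k+1) p - g k p) ^ 2 ∂γ := by
        apply integral_mono_of_nonneg
        · exact Eventually.of_forall fun p => by positivity
        · exact hint2
        · exact Eventually.of_forall htel
    _ = ((m + 1 : ℕ) : ℝ) ^ 2 * ∫ p, G p ∂γ := by
        rw [integral_const_mul, integral_finsetSum _ fun k _ => hGk k]
        simp only [hGi]
        simp
        ring

lemma gauss_poincare {n : ℕ} {F : EU n → ℝ} (hF : LipschitzWith 1 F) :
    ∫ p : EU n × EU n, (F p.2 - F p.1) ^ 2 ∂((stdGaussian (EU n)).prod (stdGaussian (EU n))) ≤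
    (Real.pi / 2) ^ 2 := by
  set γ := (stdGaussian (EU n)).prod (stdGaussian (EU n)) with hγ
  let δ : ℕ → ℝ := fun m => Real.pi / 2 / ((m + 1 : ℕ) : ℝ)
  have hδ0 : ∀ m, 0 < δ m := fun m => by
    have := Real.pi_pos
    positivity
  let Q : ℕ → EU n × EU n → ℝ := fun m p =>
    ((F (ContinuousLinearMap.rotation (δ m) p).1 - F p.1) / δ m) ^ 2
  have hδlim : Tendsto δ atTop (𝓝 0) := by
    have h := (tendsto_const_div_atTop_nhds_zero_nat (Real.pi / 2)).comp (tendsto_add_atTop_nat 1)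
    exact h
  have hdiff : ∀ᵐ p ∂γ, DifferentiableAt ℝ F p.1 := by
    have h1 : ∀ᵐ x ∂(stdGaussian (EU n)), DifferentiableAt ℝ F x :=
      (gauss_ac n).ae_le (hF.ae_differentiableAt)
    exact Measure.quasiMeasurePreserving_fst.ae h1
  have hb : ∀ m p, ‖Q m p‖ ≤ (2 * ‖p‖) ^ 2 := by
    intro m p
    simp only [Q]
    rw [Real.norm_eq_abs, abs_pow, abs_div, abs_of_pos (hδ0 m)]
    refine pow_le_pow_left₀ (by have := hδ0 m; positivity) ?_ 2
    rw [div_le_iff₀ (hδ0 m)]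
    have := rot_lip hF (δ m) p
    rw [abs_of_pos (hδ0 m)] at this
    linarith
  have hmeas : ∀ m, AEStronglyMeasurable (Q m) γ := by
    intro m
    have hc := hF.continuous
    have : Continuous (Q m) := by
      simp only [Q]
      fun_prop
    exact this.aestronglyMeasurable
  have hlim : ∀ᵐ p ∂γ, Tendsto (fun m => Q m p) atTop (𝓝 ((fderiv ℝ F p.1 p.2) ^ 2)) := by
    filter_upwards [hdiff] with p hp
    have hc : HasDerivAt (fun t : ℝ => Real.cos t • p.1 + Real.sin t • p.2) p.2 0 := by
      have h1 := ((Real.hasDerivAt_cos 0).smul_const p.1).add ((Real.hasDerivAt_sin 0).smul_const p.2)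
      simp only [Real.sin_zero, Real.cos_zero, neg_zero, zero_smul, one_smul, zero_add] at h1
      exact h1
    have h2 : HasDerivAt (fun t : ℝ => F (Real.cos t • p.1 + Real.sin t • p.2)) (fderiv ℝ F p.1 p.2) 0 := by
      have h3 : HasFDerivAt F (fderiv ℝ F p.1) (Real.cos 0 • p.1 + Real.sin 0 • p.2) := by
        simpa using hp.hasFDerivAt
      exact h3.comp_hasDerivAt (0 : ℝ) hc
    have h4 := h2.tendsto_slope_zero
    have h5 : Tendsto δ atTop (𝓝[≠] 0) :=
      tendsto_nhdsWithin_iff.2 ⟨hδlim, Eventually.of_forall fun m => (hδ0 m).ne'⟩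
    have h6 := (h4.comp h5).pow 2
    refine h6.congr fun m => ?_
    simp [Q, ContinuousLinearMap.rotation_apply]
    ring
  have hfm : AEStronglyMeasurable (fun p : EU n × EU n => (fderiv ℝ F p.1 p.2) ^ 2) γ :=
    aestronglyMeasurable_of_tendsto_ae atTop hmeas hlim
  have hfi : Integrable (fun p : EU n × EU n => (fderiv ℝ F p.1 p.2) ^ 2) γ := by
    refine (gauss_prod_sq_int n).mono' hfm ?_
    filter_upwards [hlim] with p hp
    exact le_of_tendsto hp.norm (Eventually.of_forall fun m => hb m p)
  have hT := tendsto_integral_of_dominated_convergence _ hmeas (gauss_prod_sq_int n)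
    (fun m => Eventually.of_forall (hb m)) hlim
  have hT2 := hT.const_mul ((Real.pi / 2) ^ 2)
  have hle := gauss_fderiv_bound hF hfi
  have hfin := ge_of_tendsto hT2 (b := ∫ p : EU n × EU n, (F p.2 - F p.1) ^ 2 ∂γ) (by
    refine Eventually.of_forall fun m => ?_
    refine (gauss_step hF m).trans (le_of_eq ?_)
    rw [← integral_const_mul, ← integral_const_mul]
    congr 1
    ext p
    simp only [Q, δ]
    have := Real.pi_pos
    field_simp)
  refine hfin.trans ?_
  have : 0 ≤ (Real.pi / 2) ^ 2 := by positivity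
  nlinarith


lemma gauss_memLp {n : ℕ} {F : EU n → ℝ} (hF : LipschitzWith 1 F) (hF0 : F 0 = 0) :
    MemLp F 2 (stdGaussian (EU n)) := by
  refine (IsGaussian.memLp_id (stdGaussian (EU n)) 2 (by norm_num)).mono
    hF.continuous.aestronglyMeasurable (Eventually.of_forall fun x => ?_)
  have := hF.dist_le_mul x 0
  simpa [dist_eq_norm, hF0] using this

lemma gauss_variance {n : ℕ} {F : EU n → ℝ} (hF : LipschitzWith 1 F) (hF0 : F 0 = 0) :
    Var[F; stdGaussian (EU n)] ≤ 2 := by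
  have hm := gauss_memLp hF hF0
  have h1 := gauss_poincare hF
  have hi := hm.integrable (by norm_num)
  have hi2 := hm.integrable_sq
  have e : ∀ p : EU n × EU n, (F p.2 - F p.1) ^ 2 = (F p.1 ^ 2 + F p.2 ^ 2) - 2 * (F p.1 * F p.2) :=
    fun p => by ring
  simp only [e] at h1
  have a1 : Integrable (fun p : EU n × EU n => F p.1 ^ 2)
    ((stdGaussian (EU n)).prod (stdGaussian (EU n))) := hi2.comp_fst _
  have a2 : Integrable (fun p : EU n × EU n => F p.2 ^ 2)
    ((stdGaussian (EU n)).prod (stdGaussian (EU n))) := hi2.comp_snd _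
  have a3 : Integrable (fun p : EU n × EU n => F p.1 * F p.2)
    ((stdGaussian (EU n)).prod (stdGaussian (EU n))) := hi.mul_prod hi
  have a12 : Integrable (fun p : EU n × EU n => F p.1 ^ 2 + F p.2 ^ 2)
    ((stdGaussian (EU n)).prod (stdGaussian (EU n))) := a1.add a2
  rw [integral_sub a12 (a3.const_mul 2), integral_add a1 a2, integral_const_mul,
    integral_prod_mul] at h1
  have b1 : ∫ p : EU n × EU n, F p.1 ^ 2 ∂((stdGaussian (EU n)).prod (stdGaussian (EU n)))
      = ∫ x, F x ^ 2 ∂(stdGaussian (EU n)) := by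
    have := integral_fun_fst (μ := stdGaussian (EU n)) (ν := stdGaussian (EU n)) (fun x => F x ^ 2)
    simpa using this
  have b2 : ∫ p : EU n × EU n, F p.2 ^ 2 ∂((stdGaussian (EU n)).prod (stdGaussian (EU n)))
      = ∫ x, F x ^ 2 ∂(stdGaussian (EU n)) := by
    have := integral_fun_snd (μ := stdGaussian (EU n)) (ν := stdGaussian (EU n)) (fun x => F x ^ 2)
    simpa using this
  rw [b1, b2] at h1
  rw [variance_eq_sub hm]
  simp only [Pi.pow_apply]
  have hpi := Real.pi_lt_four
  have hpi0 := Real.pi_pos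
  nlinarith

/-- the standard basis vector -/
noncomputable abbrev eb {n : ℕ} (i : Fin n) : EU n := EuclideanSpace.single i 1

lemma inner_eb_left {n : ℕ} (i : Fin n) (g : EU n) : inner ℝ (eb i) g = g i := by
  simp [eb, EuclideanSpace.inner_single_left]

lemma inner_eb_right {n : ℕ} (i : Fin n) (g : EU n) : inner ℝ g (eb i) = g i := by
  simp [eb, EuclideanSpace.inner_single_right]

lemma gauss_small_prob (R : ℝ) : ∃ N₀ : ℕ, ∀ N ≥ N₀,
    stdGaussian (EU N) {g | ∀ i, |g i| < R} ≤ 1 / 2 := by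
  set q := gaussianReal 0 1 (Set.Ioo (-R) R) with hq
  have hq1 : q < 1 := by
    refine lt_of_le_of_ne prob_le_one fun h => ?_
    have h2 : gaussianReal 0 1 (Set.Ioo (-R) R)ᶜ = 0 := by
      rw [prob_compl_eq_zero_iff measurableSet_Ioo]; exact h
    have h3 := gaussianReal_absolutelyContinuous' 0 (one_ne_zero) h2
    have h4 : (volume : Measure ℝ) (Set.Ici R) = 0 := by
      refine measure_mono_null (fun x hx => ?_) h3
      simp only [Set.mem_compl_iff, Set.mem_Ioo, not_and, not_lt]
      exact fun _ => hx
    simp at h4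
  have ht := ENNReal.tendsto_pow_atTop_nhds_zero_of_lt_one hq1
  obtain ⟨N₀, hN⟩ := eventually_atTop.1 (ht.eventually_le_const (show (0 : ENNReal) < 1 / 2 by simp))
  refine ⟨N₀, fun N hNN => ?_⟩
  rw [← map_pi_eq_stdGaussian, Measure.map_apply (by fun_prop)]
  · have : (WithLp.toLp 2 ⁻¹' {g : EU N | ∀ i, |g i| < R}) = Set.univ.pi fun _ => Set.Ioo (-R) R := by
      ext x
      simp [abs_lt, Set.mem_pi]
    rw [this, Measure.pi_pi]
    simpa using hN N hNN
  · have : {g : EU N | ∀ i, |g i| < R} = ⋂ i, {g : EU N | |g i| < R} := by ext; simp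
    rw [this]
    exact MeasurableSet.iInter fun i => measurableSet_lt (by fun_prop) (by fun_prop)

lemma gauss_map_coiso {m n : ℕ} (L : EU m →L[ℝ] EU n)
    (M : EU n → EU m) (hLM : ∀ x t, inner ℝ (L x) t = inner ℝ x (M t)) (hM : ∀ t, ‖M t‖ = ‖t‖) :
    (stdGaussian (EU m)).map L = stdGaussian (EU n) := by
  have : IsProbabilityMeasure ((stdGaussian (EU m)).map L) :=
    Measure.isProbabilityMeasure_map L.continuous.measurable.aemeasurable
  apply Measure.ext_of_charFun
  ext t
  rw [charFun_stdGaussian, charFun_apply, integral_map (by fun_prop)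
    (Measurable.aestronglyMeasurable (by fun_prop))]
  simp only [hLM]
  rw [← charFun_apply, charFun_stdGaussian, hM]

lemma gauss_mean_large {N : ℕ} {V : Type*} [NormedAddCommGroup V] [NormedSpace ℝ V]
    (u : EU N →ₗ[ℝ] V) (hu : ∀ a, ‖u a‖ ≤ ‖a‖) (c : ℝ) (hc : ∀ i, c ≤ ‖u (eb i)‖) (hc0 : 0 ≤ c)
    (R : ℝ) (hR : 0 ≤ R)
    (hN : stdGaussian (EU N) {g | ∀ i, |g i| < R} ≤ 1 / 2) :
    R * c / 2 ≤ ∫ g, ‖u g‖ ∂(stdGaussian (EU N)) := by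
  set γ := stdGaussian (EU N) with hγ
  let F : EU N → ℝ := fun g => ‖u g‖
  have hFc : Continuous F := (u.continuous_of_finiteDimensional).norm
  have hFi : Integrable F γ := by
    refine (IsGaussian.integrable_id (μ := γ)).norm.mono' hFc.aestronglyMeasurable
      (Eventually.of_forall fun x => ?_)
    simp only [F, norm_norm, id]
    exact hu x
  let A : Fin N → Set (EU N) := fun i => {g | R ≤ |g i| ∧ ∀ j < i, |g j| < R}
  have hAm : ∀ i, MeasurableSet (A i) := by
    intro i
    have : A i = {g : EU N | R ≤ |g i|} ∩ ⋂ j, ⋂ (_ : j < i), {g : EU N | |g j| < R} := by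
      ext; simp [A]
    rw [this]
    refine (measurableSet_le (by fun_prop) (by fun_prop)).inter ?_
    exact MeasurableSet.iInter fun j => MeasurableSet.iInter fun _ =>
      measurableSet_lt (by fun_prop) (by fun_prop)
  have hdis : Pairwise (Function.onFun Disjoint A) := by
    have key : ∀ i j, i < j → Disjoint (A i) (A j) := by
      intro i j hij
      rw [Set.disjoint_left]
      rintro g ⟨h1, _⟩ ⟨_, h2⟩
      exact absurd (h2 i hij) (not_lt.2 h1)
    intro i j hij
    rcases lt_or_gt_of_ne hij with h | h
    · exact key i j h
    · exact (key j i h).symm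
  have hU : (⋃ i, A i) = {g : EU N | ∀ i, |g i| < R}ᶜ := by
    ext g
    simp only [Set.mem_iUnion, Set.mem_compl_iff, Set.mem_ofPred_eq, not_forall, not_lt]
    constructor
    · rintro ⟨i, h, _⟩; exact ⟨i, h⟩
    · rintro h
      classical
      obtain ⟨i, hi, hmin⟩ : ∃ i, R ≤ |g i| ∧ ∀ j < i, ¬ R ≤ |g j| := by
        obtain ⟨i, hi⟩ := h
        obtain ⟨m, hm, hm2⟩ := WellFounded.has_min (wellFounded_lt (α := Fin N))
          {i | R ≤ |g i|} ⟨i, hi⟩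
        exact ⟨m, hm, fun j hj hj2 => hm2 j hj2 hj⟩
      exact ⟨i, hi, fun j hj => not_le.1 (hmin j hj)⟩
  have hms : MeasurableSet {g : EU N | ∀ i, |g i| < R} := by
    have := (MeasurableSet.iUnion hAm)
    rw [hU] at this
    exact this.of_compl
  have hprob : 1 / 2 ≤ γ.real (⋃ i, A i) := by
    rw [hU, probReal_compl_eq_one_sub hms]
    have : γ.real {g : EU N | ∀ i, |g i| < R} ≤ 1 / 2 := by
      have := ENNReal.toReal_mono (by simp) hN
      simpa [Measure.real] using this
    linarith
  -- the reflections
  have hrefl : ∀ i : Fin N, R * c * γ.real (A i) ≤ ∫ g in A i, F g ∂γ := by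
    intro i
    let ρ : EU N →L[ℝ] EU N := (2 : ℝ) • ((innerSL ℝ (eb i)).smulRight (eb i)) - ContinuousLinearMap.id ℝ (EU N)
    have hρ : ∀ g, ρ g = (2 * g i) • eb i - g := by
      intro g
      simp [ρ, smul_smul, inner_eb_left]
    have hρj : ∀ g j, |ρ g j| = |g j| := by
      intro g j
      rw [hρ]
      by_cases h : j = i
      · subst h; simp; congr 1; ring
      · simp [h]
    have hmap : MeasurePreserving ρ γ γ := by
      refine ⟨ρ.continuous.measurable, ?_⟩
      refine gauss_map_coiso ρ ρ ?_ ?_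
      · intro x t
        rw [hρ, hρ, inner_sub_left, inner_sub_right, inner_smul_left, inner_smul_right,
          inner_eb_left, inner_eb_right]
        simp
        ring
      · intro t
        rw [EuclideanSpace.norm_eq, EuclideanSpace.norm_eq]
        congr 1
        refine Finset.sum_congr rfl fun j _ => ?_
        rw [Real.norm_eq_abs, hρj, Real.norm_eq_abs]
    have hpre : ρ ⁻¹' (A i) = A i := by
      ext g
      simp [A, hρj]
    have h1 : ∫ g in A i, F (ρ g) ∂γ = ∫ g in A i, F g ∂γ := by
      have h2 := setIntegral_map (μ := γ) (f := F) (hAm i) hFc.aestronglyMeasurable hmap.measurable.aemeasurable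
      rw [hmap.map_eq, hpre] at h2
      exact h2.symm
    have h3 : ∀ g ∈ A i, 2 * (R * c) ≤ F g + F (ρ g) := by
      intro g hg
      have h4 : ‖u (g + ρ g)‖ ≤ F g + F (ρ g) := by
        rw [map_add]; exact norm_add_le _ _
      have h5 : g + ρ g = (2 * g i) • eb i := by rw [hρ]; abel
      rw [h5, map_smul, norm_smul, Real.norm_eq_abs, abs_mul, abs_two] at h4
      have h6 : R * c ≤ |g i| * ‖u (eb i)‖ := by
        have := hg.1
        have := hc i
        gcongr
      linarith
    have hFρ : Integrable (fun g => F (ρ g)) γ := hmap.integrable_comp_of_integrable hFi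
    have h7 : ∫ g in A i, (2 * (R * c)) ∂γ ≤ ∫ g in A i, (F g + F (ρ g)) ∂γ := by
      refine setIntegral_mono_on (integrable_const _).integrableOn (hFi.add hFρ).integrableOn (hAm i) h3
    rw [integral_add hFi.integrableOn hFρ.integrableOn, h1, setIntegral_const, smul_eq_mul] at h7
    linarith
  have hsum : ∑ i, ∫ g in A i, F g ∂γ = ∫ g in ⋃ i, A i, F g ∂γ :=
    (integral_iUnion_fintype hAm hdis fun i => hFi.integrableOn).symm
  have hreal : γ.real (⋃ i, A i) = ∑ i, γ.real (A i) :=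
    measureReal_iUnion_fintype hdis hAm
  calc R * c / 2 ≤ R * c * γ.real (⋃ i, A i) := by
        have : 0 ≤ R * c := by positivity
        nlinarith
    _ = ∑ i, R * c * γ.real (A i) := by rw [hreal, Finset.mul_sum]
    _ ≤ ∑ i, ∫ g in A i, F g ∂γ := Finset.sum_le_sum fun i _ => hrefl i
    _ = ∫ g in ⋃ i, A i, F g ∂γ := hsum
    _ ≤ ∫ g, F g ∂γ := setIntegral_le_integral hFi (Eventually.of_forall fun g => norm_nonneg _)


/-- `G ↦ (∑ j, a j * G (j, i))_i`, for a matrix `G` flattened to a vector. -/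
noncomputable def gmat {k N : ℕ} (a : EU k) : EU (k * N) →L[ℝ] EU N :=
  LinearMap.toContinuousLinearMap
    { toFun := fun G => WithLp.toLp 2 (fun i => ∑ j, a j * G (finProdFinEquiv (j, i)))
      map_add' := by
        intro x y
        ext i
        simp [mul_add, Finset.sum_add_distrib]
      map_smul' := by
        intro c x
        ext i
        simp [Finset.mul_sum, mul_left_comm] }

lemma gmat_apply {k N : ℕ} (a : EU k) (G : EU (k * N)) (i : Fin N) :
    gmat a G i = ∑ j, a j * G (finProdFinEquiv (j, i)) := rfl

lemma gmat_map {k N : ℕ} (a : EU k) (ha : ‖a‖ = 1) :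
    (stdGaussian (EU (k * N))).map (gmat a) = stdGaussian (EU N) := by
  refine gauss_map_coiso _ (fun t => WithLp.toLp 2 (fun l =>
    a (finProdFinEquiv.symm l).1 * t (finProdFinEquiv.symm l).2)) ?_ ?_
  · intro x t
    simp only [PiLp.inner_apply, gmat_apply, RCLike.inner_apply, conj_trivial, Finset.mul_sum]
    rw [← (finProdFinEquiv (m := k) (n := N)).sum_comp, Fintype.sum_prod_type, Finset.sum_comm]
    refine Finset.sum_congr rfl fun j _ => Finset.sum_congr rfl fun i _ => ?_
    simp
    ring
  · intro t
    have h1 : ‖(WithLp.toLp 2 (fun l => a (finProdFinEquiv.symm l).1 * t (finProdFinEquiv.symm l).2)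
        : EU (k * N))‖ ^ 2 = ‖t‖ ^ 2 := by
      rw [EuclideanSpace.norm_sq_eq, EuclideanSpace.norm_sq_eq]
      simp only
      rw [← (finProdFinEquiv (m := k) (n := N)).sum_comp, Fintype.sum_prod_type]
      simp only [Equiv.symm_apply_apply, norm_mul, mul_pow]
      rw [← Finset.sum_mul_sum, ← EuclideanSpace.norm_sq_eq, ha]
      simp
    exact (pow_left_inj₀ (norm_nonneg _) (norm_nonneg _) two_ne_zero).1 h1

/-- net argument -/
lemma net_argument {k : ℕ} {V : Type*} [NormedAddCommGroup V] [NormedSpace ℝ V]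
    (S : EU k →ₗ[ℝ] V) (M : ℝ) (hM : 0 < M) (t : Set (EU k))
    (ht : Metric.sphere (0 : EU k) 1 ⊆ ⋃ x ∈ t, Metric.ball x (1 / 4))
    (hS : ∀ a ∈ t, |‖S a‖ - M| ≤ M / 10) :
    ∃ S' : EU k →ₗ[ℝ] V, ∀ a, ‖a‖ ≤ ‖S' a‖ ∧ ‖S' a‖ ≤ 3 * ‖a‖ := by
  let T := LinearMap.toContinuousLinearMap S
  have hT : ∀ a, T a = S a := fun a => rfl
  have hnear : ∀ a : EU k, ‖a‖ = 1 → |‖S a‖ - M| ≤ M / 10 + ‖T‖ / 4 := by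
    intro a ha
    have := ht (show a ∈ Metric.sphere (0 : EU k) 1 by simpa using ha)
    simp only [Set.mem_iUnion, exists_prop] at this
    obtain ⟨b, hb, hab⟩ := this
    rw [Metric.mem_ball, dist_eq_norm] at hab
    have h1 := hS b hb
    have h2 : ‖S a - S b‖ ≤ ‖T‖ / 4 := by
      have h3 := T.le_opNorm (a - b)
      rw [map_sub, hT, hT] at h3
      have := norm_nonneg T
      nlinarith
    have h4 := abs_norm_sub_norm_le (S a) (S b)
    have h5 : |‖S a‖ - M| ≤ |‖S a‖ - ‖S b‖| + |‖S b‖ - M| := abs_sub_le _ _ _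
    linarith
  have hhom : ∀ (P : ℝ → Prop) (a : EU k), a ≠ 0 → (∀ b : EU k, ‖b‖ = 1 → P ‖S b‖) → P (‖S a‖ / ‖a‖) := by
    intro P a ha h
    have h1 := h (‖a‖⁻¹ • a) (by rw [norm_smul, norm_inv, norm_norm]; exact inv_mul_cancel₀ (norm_ne_zero_iff.2 ha))
    rw [map_smul, norm_smul, norm_inv, norm_norm] at h1
    rwa [div_eq_inv_mul]
  have hB : ‖T‖ ≤ 11 / 10 * M + ‖T‖ / 4 := by
    refine T.opNorm_le_bound (by positivity) fun a => ?_
    by_cases ha : a = 0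
    · simp [ha]
    have h1 := hhom (fun r => r ≤ 11 / 10 * M + ‖T‖ / 4) a ha (fun b hb => by
      have := abs_le.1 (hnear b hb)
      linarith [this.2])
    rw [div_le_iff₀ (norm_pos_iff.2 ha)] at h1
    exact h1
  have hlow : ∀ a, 16 / 30 * M * ‖a‖ ≤ ‖S a‖ := by
    intro a
    by_cases ha : a = 0
    · simp [ha]
    have h1 := hhom (fun r => 16 / 30 * M ≤ r) a ha (fun b hb => by
      have := abs_le.1 (hnear b hb)
      linarith [this.1])
    rwa [le_div_iff₀ (norm_pos_iff.2 ha)] at h1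
  refine ⟨(30 / (16 * M)) • S, fun a => ?_⟩
  rw [LinearMap.smul_apply, norm_smul, Real.norm_eq_abs, abs_of_pos (by positivity)]
  have h1 := hlow a
  have h2 := T.le_opNorm a
  rw [hT] at h2
  have h3 : ‖S a‖ ≤ 44 / 30 * M * ‖a‖ := by
    have := norm_nonneg a
    have : ‖T‖ ≤ 44 / 30 * M := by linarith
    exact h2.trans (by gcongr)
  constructor
  · calc ‖a‖ = 30 / (16 * M) * (16 / 30 * M * ‖a‖) := by field_simp
      _ ≤ _ := by gcongr
  · calc 30 / (16 * M) * ‖S a‖ ≤ 30 / (16 * M) * (44 / 30 * M * ‖a‖) := by gcongr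
      _ = 44 / 16 * ‖a‖ := by field_simp
      _ ≤ 3 * ‖a‖ := by gcongr; norm_num

lemma random_op (k : ℕ) : ∃ K : ℝ, 0 < K ∧ ∀ (V : Type*) [NormedAddCommGroup V] [NormedSpace ℝ V]
    (N : ℕ) (u : EU N →ₗ[ℝ] V), (∀ a, ‖u a‖ ≤ ‖a‖) →
    K ≤ ∫ g, ‖u g‖ ∂(stdGaussian (EU N)) →
    ∃ S' : EU k →ₗ[ℝ] V, ∀ a, ‖a‖ ≤ ‖S' a‖ ∧ ‖S' a‖ ≤ 3 * ‖a‖ := by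
  obtain ⟨t, hts, htf, htc⟩ := (isCompact_sphere (0 : EU k) 1).finite_cover_balls
    (e := 1 / 4) (by norm_num)
  lift t to Finset (EU k) using htf
  refine ⟨20 * (t.card + 1), by positivity, ?_⟩
  intro V _ _ N u hu hK
  set M := ∫ g, ‖u g‖ ∂(stdGaussian (EU N)) with hM
  have hM0 : 0 < M := lt_of_lt_of_le (by positivity) hK
  let F : EU N → ℝ := fun g => ‖u g‖
  have hF : LipschitzWith 1 F := by
    refine LipschitzWith.of_dist_le_mul fun x y => ?_
    rw [Real.dist_eq, dist_eq_norm, NNReal.coe_one, one_mul]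
    refine (abs_norm_sub_norm_le _ _).trans ?_
    rw [← map_sub]
    exact hu _
  have hF0 : F 0 = 0 := by simp [F]
  have hvar := gauss_variance hF hF0
  have hcheb := meas_ge_le_variance_div_sq (gauss_memLp hF hF0) (c := M / 10) (by positivity)
  have hbad1 : stdGaussian (EU N) {g | M / 10 ≤ |F g - M|} ≤ ENNReal.ofReal (200 / M ^ 2) := by
    refine hcheb.trans (ENNReal.ofReal_le_ofReal ?_)
    rw [div_le_div_iff₀ (by positivity) (by positivity)]
    nlinarith [sq_nonneg M]
  have hmeas : MeasurableSet {g | M / 10 ≤ |F g - M|} :=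
    measurableSet_le (by fun_prop) (by have := hF.continuous; fun_prop)
  let bad : EU k → Set (EU (k * N)) := fun a => {G | M / 10 ≤ |F (gmat a G) - M|}
  have hbad : ∀ a ∈ t, stdGaussian (EU (k * N)) (bad a) ≤ ENNReal.ofReal (200 / M ^ 2) := by
    intro a ha
    have ha1 : ‖a‖ = 1 := by simpa using hts ha
    rw [← gmat_map a ha1, Measure.map_apply (gmat a).continuous.measurable hmeas] at hbad1
    exact hbad1
  have hun : stdGaussian (EU (k * N)) (⋃ a ∈ t, bad a) < 1 := by
    calc stdGaussian (EU (k * N)) (⋃ a ∈ t, bad a)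
        ≤ ∑ a ∈ t, stdGaussian (EU (k * N)) (bad a) := measure_biUnion_finset_le _ _
      _ ≤ ∑ a ∈ t, ENNReal.ofReal (200 / M ^ 2) := Finset.sum_le_sum hbad
      _ = ENNReal.ofReal (t.card * (200 / M ^ 2)) := by
          rw [Finset.sum_const, nsmul_eq_mul, ENNReal.ofReal_mul (by positivity)]
          simp
      _ < 1 := by
          rw [ENNReal.ofReal_lt_one, ← mul_div_assoc, div_lt_one (by positivity)]
          have h0 : (0 : ℝ) ≤ t.card := by positivity
          nlinarith
  obtain ⟨G, hG⟩ : ∃ G, G ∉ ⋃ a ∈ t, bad a := by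
    by_contra! h
    rw [Set.eq_univ_of_forall h] at hun
    simp at hun
  let S : EU k →ₗ[ℝ] V :=
    { toFun := fun a => u (gmat a G)
      map_add' := by
        intro a b
        rw [← map_add]
        congr 1
        ext i
        simp [gmat_apply, add_mul, Finset.sum_add_distrib]
      map_smul' := by
        intro c a
        rw [← map_smul]
        congr 1
        ext i
        simp [gmat_apply, mul_assoc, Finset.mul_sum] }
  refine net_argument S M hM0 t (by simpa using htc) ?_
  intro a ha
  simp only [Set.mem_iUnion, not_exists] at hG
  have := hG a ha
  simp only [bad, Set.mem_ofPred_eq, not_le] at this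
  exact this.le


lemma exists_inj_map {V : Type*} [NormedAddCommGroup V] [NormedSpace ℝ V]
    (hV : ¬ FiniteDimensional ℝ V) (m : ℕ) : ∃ j : EU m →ₗ[ℝ] V, Function.Injective j := by
  have h1 : ((m : ℕ) : Cardinal) ≤ Module.rank ℝ V := by
    have : Cardinal.aleph0 ≤ Module.rank ℝ V := by
      by_contra h
      exact hV (Module.rank_lt_aleph0_iff.1 (not_le.1 h))
    exact (Cardinal.natCast_le_aleph0).trans this
  obtain ⟨f, hf⟩ := Module.le_rank_iff_exists_linearMap.1 h1
  exact ⟨f ∘ₗ (WithLp.linearEquiv 2 ℝ (Fin m → ℝ)).toLinearMap,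
    hf.comp (WithLp.linearEquiv 2 ℝ (Fin m → ℝ)).injective⟩

/-- maximal volume ellipsoid -/
lemma exists_max_det {V : Type*} [NormedAddCommGroup V] [NormedSpace ℝ V]
    (hV : ¬ FiniteDimensional ℝ V) (m : ℕ) : ∃ u : EU m →ₗ[ℝ] V, (∀ a, ‖u a‖ ≤ ‖a‖) ∧
    ∀ (v : EU m →ₗ[ℝ] EU m) (s : ℝ), 0 < s → (∀ a, ‖u (v a)‖ ≤ s * ‖a‖) →
      |LinearMap.det v| ≤ s ^ m := by
  obtain ⟨j, hj⟩ := exists_inj_map hV m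
  obtain ⟨C, hC0, hC⟩ := j.exists_antilipschitzWith (LinearMap.ker_eq_bot.2 hj)
  have hCb : ∀ x, ‖x‖ ≤ C * ‖j x‖ := by
    intro x
    have := hC.le_mul_dist x 0
    simpa using this
  let J := LinearMap.toContinuousLinearMap j
  have hJ : ∀ x, J x = j x := fun _ => rfl
  let K : Set (EU m →L[ℝ] EU m) := {w | ∀ a, ‖J (w a)‖ ≤ ‖a‖}
  have hKc : IsClosed K := by
    have : K = ⋂ a, {w : EU m →L[ℝ] EU m | ‖J (w a)‖ ≤ ‖a‖} := by ext; simp [K]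
    rw [this]
    refine isClosed_iInter fun a => isClosed_le ?_ continuous_const
    fun_prop
  have hKb : K ⊆ Metric.closedBall 0 C := by
    intro w hw
    rw [mem_closedBall_zero_iff]
    refine w.opNorm_le_bound C.coe_nonneg fun a => (hCb _).trans ?_
    gcongr
    exact hw a
  have hKcomp : IsCompact K := (isCompact_closedBall 0 (C : ℝ)).of_isClosed_subset hKc hKb
  have hdetc : Continuous fun f : EU m →L[ℝ] EU m => |f.det| :=
    (ContinuousLinearMap.continuous_det).abs
  obtain ⟨w, hwK, hw⟩ := hKcomp.exists_isMaxOn ⟨0, by intro a; simp⟩ hdetc.continuousOn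
  have hw' : ∀ w' ∈ K, |w'.det| ≤ |w.det| := fun w' h => hw h
  have hdet : ∀ f : EU m →L[ℝ] EU m, f.det = LinearMap.det (f : EU m →ₗ[ℝ] EU m) := fun _ => rfl
  have hpos : 0 < |w.det| := by
    have hmem : ((1 + ‖J‖)⁻¹ • ContinuousLinearMap.id ℝ (EU m)) ∈ K := by
      intro a
      simp only [smul_apply, ContinuousLinearMap.id_apply, map_smul, norm_smul]
      rw [norm_inv, Real.norm_of_nonneg (by positivity), inv_mul_le_iff₀ (by positivity)]
      have := J.le_opNorm a
      nlinarith [norm_nonneg a]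
    refine lt_of_lt_of_le ?_ (hw' _ hmem)
    rw [hdet]
    simp only [ContinuousLinearMap.toLinearMap_smul, LinearMap.det_smul, ContinuousLinearMap.coe_id,
      LinearMap.det_id, mul_one]
    positivity
  refine ⟨j ∘ₗ w.toLinearMap, hwK, ?_⟩
  intro v s hs hv
  have hmem : LinearMap.toContinuousLinearMap (s⁻¹ • (w.toLinearMap ∘ₗ v)) ∈ K := by
    intro a
    have h1 := hv a
    change ‖J (s⁻¹ • w (v a))‖ ≤ ‖a‖
    rw [map_smul, norm_smul, norm_inv, Real.norm_of_nonneg hs.le, inv_mul_le_iff₀ hs]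
    exact h1
  have h2 := hw' _ hmem
  rw [hdet, hdet] at h2
  simp only [LinearMap.coe_toContinuousLinearMap, LinearMap.det_smul, LinearMap.det_comp,
    abs_mul, abs_pow, abs_inv, abs_of_pos hs] at h2
  rw [finrank_euclideanSpace_fin, inv_pow, inv_mul_le_iff₀ (by positivity)] at h2
  rw [hdet] at hpos
  have h3 : |LinearMap.det (w : EU m →ₗ[ℝ] EU m)| * |LinearMap.det v| ≤
    |LinearMap.det (w : EU m →ₗ[ℝ] EU m)| * s ^ m := by linarith
  exact le_of_mul_le_mul_left h3 hpos

lemma det_one_add_proj {m : ℕ} (U : Submodule ℝ (EU m)) :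
    LinearMap.det (LinearMap.id + (U.starProjection : EU m →ₗ[ℝ] EU m)) = 2 ^ Module.finrank ℝ U := by
  let e := Submodule.prodEquivOfIsCompl U Uᗮ U.isCompl_orthogonal
  have h : LinearMap.id + (U.starProjection : EU m →ₗ[ℝ] EU m) =
      e.toLinearMap ∘ₗ (LinearMap.prodMap ((2 : ℝ) • LinearMap.id) LinearMap.id) ∘ₗ e.symm.toLinearMap := by
    apply LinearMap.ext
    intro x
    obtain ⟨⟨a, b⟩, rfl⟩ := e.surjective x
    have ha : U.starProjection (a : EU m) = a := Submodule.starProjection_eq_self_iff.2 a.2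
    have hb : U.starProjection (b : EU m) = 0 := (Submodule.starProjection_apply_eq_zero_iff U).2 b.2
    simp [e, ha, hb]
    module
  rw [h, LinearMap.det_conj, LinearMap.det_prodMap, LinearMap.det_smul]
  simp

lemma dr_extend {V : Type*} [NormedAddCommGroup V] [NormedSpace ℝ V] {n : ℕ} (u : EU (2 * n) →ₗ[ℝ] V)
    (hu : ∀ a, ‖u a‖ ≤ ‖a‖)
    (hd : ∀ (v : EU (2 * n) →ₗ[ℝ] EU (2 * n)) (s : ℝ), 0 < s → (∀ a, ‖u (v a)‖ ≤ s * ‖a‖) →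
      |LinearMap.det v| ≤ s ^ (2 * n)) {k : ℕ} (hk : k < n) (e : Fin k → EU (2 * n))
    (he : Orthonormal ℝ e) :
    ∃ b : EU (2 * n), ‖b‖ = 1 ∧ (∀ i, inner ℝ (e i) b = 0) ∧ 1 / 4 ≤ ‖u b‖ := by
  by_contra! hcon
  set S := Submodule.span ℝ (Set.range e) with hS
  have hfin : Module.finrank ℝ S = k := by
    rw [hS, finrank_span_eq_card he.linearIndependent, Fintype.card_fin]
  have hfin2 := S.finrank_add_finrank_orthogonal
  rw [hfin, finrank_euclideanSpace_fin] at hfin2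
  have hsmall : ∀ b ∈ Sᗮ, ‖u b‖ ≤ 1 / 4 * ‖b‖ := by
    intro b hb
    by_cases hb0 : b = 0
    · simp [hb0]
    have h1 := hcon (‖b‖⁻¹ • b)
      (by rw [norm_smul, norm_inv, norm_norm]; exact inv_mul_cancel₀ (norm_ne_zero_iff.2 hb0))
      (fun i => by
        rw [inner_smul_right, (Submodule.mem_orthogonal _ _).1 hb _ (Submodule.subset_span ⟨i, rfl⟩), mul_zero])
    rw [map_smul, norm_smul, norm_inv, norm_norm, inv_mul_lt_iff₀ (norm_pos_iff.2 hb0)] at h1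
    linarith
  have h2 := hd (LinearMap.id + ((Sᗮ).starProjection : EU (2 * n) →ₗ[ℝ] EU (2 * n))) (5 / 4) (by norm_num) (by
    intro a
    have h3 : ‖(Sᗮ).starProjection a‖ ≤ ‖a‖ := by
      have h4 := (Sᗮ).starProjection.le_opNorm a
      have h5 := (Sᗮ).starProjection_norm_le
      nlinarith [norm_nonneg a]
    have h6 := hsmall ((Sᗮ).starProjection a) (Submodule.starProjection_apply_mem _ _)
    have h7 := hu a
    simp only [LinearMap.add_apply, LinearMap.id_apply, ContinuousLinearMap.coe_coe, map_add]
    refine (norm_add_le _ _).trans ?_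
    linarith)
  rw [det_one_add_proj, abs_of_nonneg (by positivity)] at h2
  have h8 : (2 : ℝ) ^ n ≤ 2 ^ Module.finrank ℝ Sᗮ := pow_le_pow_right₀ (by norm_num) (by omega)
  have h9 : ((5 / 4 : ℝ) ^ (2 * n)) < 2 ^ n := by
    rw [pow_mul]
    exact pow_lt_pow_left₀ (by norm_num) (by norm_num) (by omega)
  linarith

lemma dr_family {V : Type*} [NormedAddCommGroup V] [NormedSpace ℝ V] {n : ℕ} (u : EU (2 * n) →ₗ[ℝ] V)
    (hu : ∀ a, ‖u a‖ ≤ ‖a‖)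
    (hd : ∀ (v : EU (2 * n) →ₗ[ℝ] EU (2 * n)) (s : ℝ), 0 < s → (∀ a, ‖u (v a)‖ ≤ s * ‖a‖) →
      |LinearMap.det v| ≤ s ^ (2 * n)) (k : ℕ) (hk : k ≤ n) :
    ∃ e : Fin k → EU (2 * n), Orthonormal ℝ e ∧ ∀ i, 1 / 4 ≤ ‖u (e i)‖ := by
  induction k with
  | zero => exact ⟨fun i => i.elim0, ⟨fun i => i.elim0, fun i => i.elim0⟩, fun i => i.elim0⟩
  | succ k ih =>
    obtain ⟨e, he, hb⟩ := ih (by omega)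
    obtain ⟨b, hb1, hb2, hb3⟩ := dr_extend u hu hd (show k < n by omega) e he
    refine ⟨Fin.snoc e b, ⟨?_, ?_⟩, ?_⟩
    · intro i
      refine Fin.lastCases ?_ (fun i => ?_) i
      · simpa using hb1
      · simpa using he.1 i
    · intro i
      refine Fin.lastCases ?_ (fun i => ?_) i
      · intro j
        refine Fin.lastCases ?_ (fun j => ?_) j
        · intro h; exact absurd rfl h
        · intro _
          simp only [Fin.snoc_last, Fin.snoc_castSucc]
          rw [real_inner_comm]; exact hb2 j
      · intro j
        refine Fin.lastCases ?_ (fun j => ?_) j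
        · intro _
          simp only [Fin.snoc_last, Fin.snoc_castSucc]
          exact hb2 i
        · intro h
          simp only [Fin.snoc_castSucc]
          exact he.2 (fun h' => h (by rw [h']))
    · intro i
      refine Fin.lastCases ?_ (fun i => ?_) i
      · simpa using hb3
      · simpa using hb i

lemma dvoretzky_rogers {V : Type*} [NormedAddCommGroup V] [NormedSpace ℝ V]
    (hV : ¬ FiniteDimensional ℝ V) (n : ℕ) : ∃ u : EU n →ₗ[ℝ] V, (∀ a, ‖u a‖ ≤ ‖a‖) ∧
    ∀ i, 1 / 4 ≤ ‖u (eb i)‖ := by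
  obtain ⟨u, hu, hd⟩ := exists_max_det hV (2 * n)
  obtain ⟨e, he, hb⟩ := dr_family u hu hd n le_rfl
  let L : EU n →ₗ[ℝ] EU (2 * n) :=
    { toFun := fun a => ∑ i, a i • e i
      map_add' := by intro a b; simp [add_smul, Finset.sum_add_distrib]
      map_smul' := by intro c a; simp [Finset.smul_sum, smul_smul] }
  have hL : ∀ a, ‖L a‖ = ‖a‖ := by
    intro a
    refine (pow_left_inj₀ (norm_nonneg _) (norm_nonneg _) two_ne_zero).1 ?_
    rw [← real_inner_self_eq_norm_sq, EuclideanSpace.norm_sq_eq]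
    change inner ℝ (∑ i, a i • e i) (∑ i, a i • e i) = _
    rw [he.inner_sum]
    refine Finset.sum_congr rfl fun i _ => ?_
    simp [sq]
  refine ⟨u ∘ₗ L, fun a => (hu _).trans (hL a).le, fun i => ?_⟩
  have : L (eb i) = e i := by
    change ∑ j, (eb i) j • e j = _
    simp [eb]
  rw [LinearMap.comp_apply, this]
  exact hb i

/-- **Dvoretzky's theorem** (isomorphic version). -/
theorem dvoretzky {V : Type*} [NormedAddCommGroup V] [NormedSpace ℝ V]
    (hV : ¬ FiniteDimensional ℝ V) (k : ℕ) :
    ∃ S : EU k →ₗ[ℝ] V, ∀ a, ‖a‖ ≤ ‖S a‖ ∧ ‖S a‖ ≤ 3 * ‖a‖ := by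
  obtain ⟨K, hK0, hK⟩ := random_op k
  obtain ⟨N, hN⟩ := gauss_small_prob (8 * K)
  obtain ⟨u, hu, hc⟩ := dvoretzky_rogers hV N
  refine hK V N u hu ?_
  have := gauss_mean_large u hu (1 / 4) hc (by norm_num) (8 * K) (by positivity) (hN N le_rfl)
  linarith


/-- Conclusion of the stability hypothesis: closed subspaces are complemented in separable extensions. -/
def SepCompl (Y : Type*) [NormedAddCommGroup Y] [NormedSpace ℝ Y] : Prop :=
  ∀ (Z : Submodule ℝ Y), IsClosed (Z : Set Y) → Z ≠ ⊥ → ∀ D : Set Y, D.Countable →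
    ∃ (W : Submodule ℝ Y) (T : W →L[ℝ] Z), Z ≤ W ∧ D ⊆ W ∧
      ∀ (w : W) (hw : (w : Y) ∈ Z), T w = ⟨w, hw⟩

lemma sepCompl_of_stable {Y : Type u} [NormedAddCommGroup Y] [NormedSpace ℝ Y] [CompleteSpace Y]
    (h : ∀ (X : Type u) [NormedAddCommGroup X] [NormedSpace ℝ X] [CompleteSpace X],
      PairStable X Y) : SepCompl Y := by
  classical
  intro Z hZ hZ0 D hD
  obtain ⟨z0, hz0, hz0n⟩ := (Submodule.ne_bot_iff Z).1 hZ0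
  have : CompleteSpace Z := hZ.completeSpace_coe
  obtain ⟨d, hd⟩ : ∃ d : ℕ → Y, D ∪ {0} = Set.range d :=
    (hD.union (Set.countable_singleton 0)).exists_eq_range ⟨0, by simp⟩
  let d' : ℕ → Y := fun k => (1 + ‖d k‖)⁻¹ • d k
  have hd' : ∀ k, ‖d' k‖ ≤ 1 := by
    intro k
    simp only [d', norm_smul, norm_inv]
    rw [Real.norm_of_nonneg (by positivity), inv_mul_le_iff₀ (by positivity)]
    linarith
  let g : Z → Y := fun z => if hz : ∃ k : ℕ, (z : Y) = ((k : ℝ) + 1) • z0 then d' hz.choose else 0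
  have hg : ∀ z, ‖g z‖ ≤ 1 := by
    intro z
    simp only [g]
    split_ifs
    · exact hd' _
    · simp
  have hgk : ∀ k : ℕ, g ⟨((k : ℝ) + 1) • z0, Z.smul_mem _ hz0⟩ = d' k := by
    intro k
    have hz : ∃ j : ℕ, ((k : ℝ) + 1) • z0 = ((j : ℝ) + 1) • z0 := ⟨k, rfl⟩
    have h1 : g ⟨((k : ℝ) + 1) • z0, Z.smul_mem _ hz0⟩ = d' hz.choose := by
      simp only [g]
      rw [dif_pos hz]
    rw [h1]
    have h2 := hz.choose_spec
    have h3 := smul_left_injective ℝ hz0n h2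
    have h4 : (k : ℝ) = hz.choose := by linarith
    congr 1
    exact_mod_cast h4.symm
  have hgo : ∀ z : Z, (¬ ∃ k : ℕ, (z : Y) = ((k : ℝ) + 1) • z0) → g z = 0 := by
    intro z hz
    simp only [g]
    rw [dif_neg hz]
  have hg0 : g 0 = 0 := by
    apply hgo
    rintro ⟨k, hk⟩
    have h1 : ((k : ℝ) + 1) ≠ 0 := by positivity
    exact (smul_ne_zero h1 hz0n) (by simpa using hk.symm)
  let f : Z → Y := fun z => (z : Y) + g z
  have hf : StdEpsIsom 2 f := by
    refine ⟨by simp [f, hg0], fun x y => ?_⟩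
    have h1 : f x - f y = ((x - y : Z) : Y) + (g x - g y) := by
      simp only [f, Submodule.coe_sub]; abel
    have h2 : ‖g x - g y‖ ≤ 2 := by
      have := norm_sub_le (g x) (g y)
      linarith [hg x, hg y]
    rw [h1]
    have h3 := abs_norm_sub_norm_le (((x - y : Z) : Y) + (g x - g y)) ((x - y : Z) : Y)
    rw [add_sub_cancel_left] at h3
    exact h3.trans h2
  obtain ⟨α, γ, hα, hγ, T, hT, hTx⟩ := h Z 2 (by norm_num) f hf
  -- Z is contained in L(f)
  have hhalf : ¬ ∃ k : ℕ, (1 / 2 : ℝ) • z0 = ((k : ℝ) + 1) • z0 := by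
    rintro ⟨k, hk⟩
    have h3 : (1 / 2 : ℝ) = (k : ℝ) + 1 := smul_left_injective ℝ hz0n hk
    have : (0 : ℝ) ≤ k := by positivity
    linarith
  have hhalf2 : ∀ k : ℕ, ¬ ∃ j : ℕ, ((k : ℝ) + 1 + 1 / 2) • z0 = ((j : ℝ) + 1) • z0 := by
    rintro k ⟨j, hj⟩
    have h3 : (k : ℝ) + 1 + 1 / 2 = (j : ℝ) + 1 := smul_left_injective ℝ hz0n hj
    have h4 : (2 * k + 1 : ℝ) = 2 * j := by linarith
    have h5 : 2 * k + 1 = 2 * j := by exact_mod_cast h4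
    omega
  have hZW : Z ≤ Lf f := by
    intro z hz
    by_cases hk : ∃ k : ℕ, z = ((k : ℝ) + 1) • z0
    · obtain ⟨k, rfl⟩ := hk
      have h1 := mem_Lf f ⟨((k : ℝ) + 1 + 1 / 2) • z0, Z.smul_mem _ hz0⟩
      have h2 := mem_Lf f ⟨(1 / 2 : ℝ) • z0, Z.smul_mem _ hz0⟩
      simp only [f] at h1 h2
      rw [hgo _ (hhalf2 k), add_zero] at h1
      rw [hgo _ hhalf, add_zero] at h2
      have h3 := (Lf f).sub_mem h1 h2
      rw [← sub_smul] at h3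
      simpa using h3
    · have h1 := mem_Lf f ⟨z, hz⟩
      simp only [f] at h1
      rw [hgo _ hk, add_zero] at h1
      exact h1
  have hDW : D ⊆ (Lf f : Set Y) := by
    intro y hy
    have : y ∈ Set.range d := by rw [← hd]; exact Or.inl hy
    obtain ⟨k, rfl⟩ := this
    have h1 := mem_Lf f ⟨((k : ℝ) + 1) • z0, Z.smul_mem _ hz0⟩
    have h2 := (Lf f).sub_mem h1 (hZW (Z.smul_mem ((k : ℝ) + 1) hz0))
    simp only [f] at h2
    rw [hgk, add_sub_cancel_left] at h2
    have h3 := (Lf f).smul_mem (1 + ‖d k‖) h2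
    simp only [d'] at h3
    rwa [smul_smul, mul_inv_cancel₀ (by positivity), one_smul] at h3
  refine ⟨Lf f, T, hZW, hDW, fun w hw => ?_⟩
  -- homogenization
  have key : ∀ n : ℕ, (n : ℝ) * ‖T w - ⟨w, hw⟩‖ ≤ γ * 2 + ‖T‖ := by
    intro n
    have h1 := hTx ((n : ℝ) • ⟨w, hw⟩)
    have hm : g ((n : ℝ) • ⟨w, hw⟩) ∈ Lf f := by
      have := (Lf f).sub_mem (mem_Lf f ((n : ℝ) • ⟨w, hw⟩)) (hZW ((n : ℝ) • (⟨w, hw⟩ : Z)).2)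
      simp only [f] at this
      rwa [add_sub_cancel_left] at this
    have h2 : (⟨f ((n : ℝ) • ⟨w, hw⟩), mem_Lf f _⟩ : Lf f) = (n : ℝ) • w + ⟨_, hm⟩ := by
      ext
      simp [f]
    rw [h2, map_add, map_smul] at h1
    have h3 : ‖T ⟨_, hm⟩‖ ≤ ‖T‖ := by
      refine (T.le_opNorm _).trans ?_
      have : ‖(⟨_, hm⟩ : Lf f)‖ ≤ 1 := hg _
      nlinarith [norm_nonneg T]
    have h4 : (n : ℝ) • (T w - ⟨w, hw⟩) = ((n : ℝ) • T w + T ⟨_, hm⟩ - (n : ℝ) • ⟨w, hw⟩) - T ⟨_, hm⟩ := by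
      rw [smul_sub]; abel
    have h5 : ‖(n : ℝ) • (T w - ⟨w, hw⟩)‖ ≤ γ * 2 + ‖T‖ := by
      rw [h4]
      exact (norm_sub_le _ _).trans (add_le_add h1 h3)
    rwa [norm_smul, Real.norm_of_nonneg (by positivity)] at h5
  by_contra hne
  have hpos : 0 < ‖T w - ⟨w, hw⟩‖ := norm_pos_iff.2 (sub_ne_zero.2 hne)
  obtain ⟨n, hn⟩ := exists_nat_gt ((γ * 2 + ‖T‖) / ‖T w - ⟨w, hw⟩‖)
  rw [div_lt_iff₀ hpos] at hn
  linarith [key n]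

/-- common kernel of finitely many functionals -/
def kerF {Y : Type*} [NormedAddCommGroup Y] [NormedSpace ℝ Y] (s : Finset (StrongDual ℝ Y)) :
    Submodule ℝ Y :=
  LinearMap.ker (LinearMap.pi fun φ : s => (φ.1 : Y →ₗ[ℝ] ℝ))

section fa
variable {Y : Type*} [NormedAddCommGroup Y] [NormedSpace ℝ Y]

lemma mem_kerF {s : Finset (StrongDual ℝ Y)} {y : Y} : y ∈ kerF s ↔ ∀ φ ∈ s, φ y = 0 := by
  simp [kerF, LinearMap.mem_ker, funext_iff]

lemma kerF_anti {s t : Finset (StrongDual ℝ Y)} (h : s ⊆ t) : kerF t ≤ kerF s := by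
  intro y hy
  rw [mem_kerF] at *
  exact fun φ hφ => hy φ (h hφ)

lemma kerF_infinite (hY : ¬ FiniteDimensional ℝ Y) (s : Finset (StrongDual ℝ Y)) :
    ¬ FiniteDimensional ℝ (kerF s) := by
  intro h
  apply hY
  have : FiniteDimensional ℝ (Y ⧸ kerF s) :=
    FiniteDimensional.of_injective
      ((LinearMap.pi fun φ : s => (φ.1 : Y →ₗ[ℝ] ℝ)).quotKerEquivRange.toLinearMap)
      (LinearEquiv.injective _)
  exact Module.Finite.of_submodule_quotient (kerF s)

lemma isClosed_sup_kerF (A : Submodule ℝ Y) [FiniteDimensional ℝ A] (s : Finset (StrongDual ℝ Y)) :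
    IsClosed ((A ⊔ kerF s : Submodule ℝ Y) : Set Y) := by
  let ℓ : Y →L[ℝ] (s → ℝ) := ContinuousLinearMap.pi fun φ : s => φ.1
  have h : A ⊔ kerF s = (A.map (ℓ : Y →ₗ[ℝ] (s → ℝ))).comap (ℓ : Y →ₗ[ℝ] (s → ℝ)) := by
    rw [Submodule.comap_map_eq]
    rfl
  rw [h]
  exact (Submodule.closed_of_finiteDimensional (A.map (ℓ : Y →ₗ[ℝ] (s → ℝ)))).preimage ℓ.continuous

lemma isClosed_kerF (s : Finset (StrongDual ℝ Y)) : IsClosed (kerF s : Set Y) := by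
  have := isClosed_sup_kerF (⊥ : Submodule ℝ Y) s
  simpa using this

lemma exists_norming (E : Submodule ℝ Y) [FiniteDimensional ℝ E] :
    ∃ s : Finset (StrongDual ℝ Y), ∀ x ∈ E, ∀ w ∈ kerF s, ‖x‖ ≤ 2 * ‖x + w‖ := by
  classical
  obtain ⟨t, hts, htf, htc⟩ := (isCompact_sphere (0 : E) 1).finite_cover_balls
    (e := 1 / 2) (by norm_num)
  have hφ : ∀ x : E, ∃ φ : StrongDual ℝ Y, ‖φ‖ ≤ 1 ∧ φ x = ‖(x : Y)‖ := by
    intro x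
    obtain ⟨φ, h1, h2⟩ := exists_dual_vector'' ℝ (x : Y)
    exact ⟨φ, h1, by simpa using h2⟩
  choose φ hφ1 hφ2 using hφ
  lift t to Finset E using htf
  refine ⟨t.image φ, ?_⟩
  have unit : ∀ x : E, ‖x‖ = 1 → ∀ w ∈ kerF (t.image φ), 1 ≤ 2 * ‖(x : Y) + w‖ := by
    intro x hx w hw
    have h1 := htc (show x ∈ Metric.sphere (0 : E) 1 by simpa using hx)
    simp only [Set.mem_iUnion, exists_prop, Finset.mem_coe] at h1
    obtain ⟨b, hb, hab⟩ := h1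
    rw [Metric.mem_ball, dist_eq_norm] at hab
    have hb1 : ‖b‖ = 1 := by simpa using hts hb
    have hw0 : φ b w = 0 := mem_kerF.1 hw _ (Finset.mem_image_of_mem _ hb)
    have h2 : φ b ((x : Y) + w) = 1 + φ b ((x - b : E) : Y) := by
      rw [map_add, hw0, Submodule.coe_sub, map_sub, hφ2]
      have : ‖(b : Y)‖ = 1 := hb1
      rw [this]; ring
    have h3 : |φ b ((x - b : E) : Y)| ≤ ‖x - b‖ := by
      have := (φ b).le_opNorm ((x - b : E) : Y)
      rw [Real.norm_eq_abs] at this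
      refine this.trans ?_
      have h4 : ‖((x - b : E) : Y)‖ = ‖x - b‖ := rfl
      rw [h4]
      nlinarith [hφ1 b, norm_nonneg (x - b)]
    have h5 : φ b ((x : Y) + w) ≤ ‖(x : Y) + w‖ := by
      have := (φ b).le_opNorm ((x : Y) + w)
      have h6 := le_abs_self (φ b ((x : Y) + w))
      rw [Real.norm_eq_abs] at this
      nlinarith [hφ1 b, norm_nonneg ((x : Y) + w)]
    have := (abs_le.1 h3).1
    linarith
  intro x hx w hw
  by_cases hx0 : x = 0
  · simp [hx0]
  have hn : ‖x‖ ≠ 0 := norm_ne_zero_iff.2 hx0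
  have h1 := unit (‖x‖⁻¹ • ⟨x, hx⟩) (by
    rw [norm_smul, norm_inv, norm_norm]
    exact inv_mul_cancel₀ hn) (‖x‖⁻¹ • w) (Submodule.smul_mem _ _ hw)
  rw [Submodule.coe_smul, ← smul_add, norm_smul, norm_inv, norm_norm] at h1
  have hp : 0 < ‖x‖ := norm_pos_iff.2 hx0
  have h2 : 2 * (‖x‖⁻¹ * ‖x + w‖) = (2 * ‖x + w‖) / ‖x‖ := by field_simp
  rw [h2, le_div_iff₀ hp] at h1
  linarith

/-- bounded projection on a direct summand -/
lemma exists_proj (E K : Submodule ℝ Y) (C : ℝ) (h : ∀ e ∈ E, ∀ k ∈ K, ‖e‖ ≤ C * ‖e + k‖) :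
    ∃ Q : (E ⊔ K : Submodule ℝ Y) →ₗ[ℝ] Y, (∀ x, Q x ∈ E) ∧ (∀ x, ‖Q x‖ ≤ C * ‖x‖) ∧
      (∀ x : (E ⊔ K : Submodule ℝ Y), ∀ e ∈ E, ∀ k ∈ K, (x : Y) = e + k → Q x = e) := by
  have huniq : ∀ e ∈ E, ∀ k ∈ K, ∀ e' ∈ E, ∀ k' ∈ K, e + k = e' + k' → e = e' := by
    intro e he k hk e' he' k' hk' heq
    have h1 := h (e - e') (E.sub_mem he he') (k - k') (K.sub_mem hk hk')
    have h2 : e - e' + (k - k') = 0 := by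
      have : e - e' + (k - k') = (e + k) - (e' + k') := by abel
      rw [this, heq, sub_self]
    rw [h2, norm_zero, mul_zero] at h1
    exact sub_eq_zero.1 (norm_le_zero_iff.1 h1)
  have hex : ∀ x : (E ⊔ K : Submodule ℝ Y), ∃ e ∈ E, ∃ k ∈ K, (x : Y) = e + k := by
    intro x
    obtain ⟨e, he, k, hk, hx⟩ := Submodule.mem_sup.1 x.2
    exact ⟨e, he, k, hk, hx.symm⟩
  choose q hq r hr hqr using hex
  have hspec : ∀ x : (E ⊔ K : Submodule ℝ Y), ∀ e ∈ E, ∀ k ∈ K, (x : Y) = e + k → q x = e := by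
    intro x e he k hk hx
    exact huniq _ (hq x) _ (hr x) _ he _ hk ((hqr x).symm.trans hx)
  refine ⟨{ toFun := q, map_add' := ?_, map_smul' := ?_ }, hq, ?_, hspec⟩
  · intro x y
    refine hspec _ _ (E.add_mem (hq x) (hq y)) _ (K.add_mem (hr x) (hr y)) ?_
    rw [Submodule.coe_add, hqr x, hqr y]; abel
  · intro c x
    refine hspec _ _ (E.smul_mem c (hq x)) _ (K.smul_mem c (hr x)) ?_
    rw [Submodule.coe_smul, hqr x, smul_add]; rfl
  · intro x
    have := h _ (hq x) _ (hr x)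
    rw [← hqr x] at this
    exact this

end fa

section loc
variable {Y : Type*} [NormedAddCommGroup Y] [NormedSpace ℝ Y]

/-- `E` is complemented with constant `lam` in every finite dimensional superspace. -/
def LocCompl (lam : ℝ) (E : Submodule ℝ Y) : Prop :=
  ∀ F : Submodule ℝ Y, FiniteDimensional ℝ F → E ≤ F →
    ∃ P : F →ₗ[ℝ] Y, (∀ x, P x ∈ E) ∧ (∀ x : F, (x : Y) ∈ E → P x = x) ∧ ∀ x, ‖P x‖ ≤ lam * ‖x‖

theorem exists_locCompl (hY : SepCompl Y) : ∃ (s : Finset (StrongDual ℝ Y)) (lam : ℕ),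
    ∀ E : Submodule ℝ Y, FiniteDimensional ℝ E → E ≤ kerF s → LocCompl (lam : ℝ) E := by
  classical
  by_contra hcon
  push Not at hcon
  choose E hEfd hEs hbad using hcon
  have hN : ∀ A : Submodule ℝ Y, ∃ s : Finset (StrongDual ℝ Y), FiniteDimensional ℝ A →
      ∀ x ∈ A, ∀ w ∈ kerF s, ‖x‖ ≤ 2 * ‖x + w‖ := by
    intro A
    by_cases hA : FiniteDimensional ℝ A
    · obtain ⟨s, hs⟩ := exists_norming A
      exact ⟨s, fun _ => hs⟩
    · exact ⟨∅, fun h => absurd h hA⟩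
  choose N hN using hN
  let st : ℕ → Finset (StrongDual ℝ Y) × Submodule ℝ Y := fun n =>
    Nat.rec (∅, ⊥) (fun n p => (p.1 ∪ N (p.2 ⊔ E p.1 n), p.2 ⊔ E p.1 n)) n
  let sn : ℕ → Finset (StrongDual ℝ Y) := fun n => (st n).1
  let a : ℕ → Submodule ℝ Y := fun n => (st n).2
  let e : ℕ → Submodule ℝ Y := fun n => E (sn n) n
  have ha0 : a 0 = ⊥ := rfl
  have ha : ∀ n, a (n + 1) = a n ⊔ e n := fun n => rfl
  have hs : ∀ n, sn (n + 1) = sn n ∪ N (a (n + 1)) := fun n => rfl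
  have hefd : ∀ n, FiniteDimensional ℝ (e n) := fun n => hEfd _ _
  have hek : ∀ n, e n ≤ kerF (sn n) := fun n => hEs _ _
  have hafd : ∀ n, FiniteDimensional ℝ (a n) := by
    intro n
    induction n with
    | zero => rw [ha0]; infer_instance
    | succ n ih => rw [ha]; have := hefd n; infer_instance
  have hbad' : ∀ n : ℕ, ¬ LocCompl ((n : ℕ) : ℝ) (e n) := fun n => hbad _ _
  clear_value e a sn
  have hnorm : ∀ n, ∀ x ∈ a n, ∀ w ∈ kerF (sn n), ‖x‖ ≤ 2 * ‖x + w‖ := by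
    intro n
    cases n with
    | zero =>
      intro x hx w hw
      rw [ha0, Submodule.mem_bot] at hx
      simp [hx]
    | succ n =>
      intro x hx w hw
      refine hN _ (hafd _) x hx w (kerF_anti ?_ hw)
      rw [hs]; exact Finset.subset_union_right
  have hsmono : Monotone sn := monotone_nat_of_le_succ fun n => by
    rw [hs]; exact Finset.subset_union_left
  have hamono : Monotone a := monotone_nat_of_le_succ fun n => by
    rw [ha]; exact le_sup_left
  let Z : Submodule ℝ Y := (⨆ n, e n).topologicalClosure
  have heZ : ∀ n, e n ≤ Z := fun n => (le_iSup e n).trans (Submodule.le_topologicalClosure _)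
  have hZle : ∀ n, Z ≤ e n ⊔ (a n ⊔ kerF (sn (n + 1))) := by
    intro n
    have h1 : e n ⊔ (a n ⊔ kerF (sn (n + 1))) = a (n + 1) ⊔ kerF (sn (n + 1)) := by
      rw [ha, ← sup_assoc, sup_comm (e n)]
    rw [h1]
    have := hafd (n + 1)
    refine Submodule.topologicalClosure_minimal _ ?_ (isClosed_sup_kerF _ _)
    refine iSup_le fun m => ?_
    rcases le_or_gt m n with hm | hm
    · refine le_trans ?_ le_sup_left
      refine le_trans ?_ (hamono (Nat.succ_le_succ hm))
      show e m ≤ a (m + 1)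
      rw [ha]; exact le_sup_right
    · exact ((hek m).trans (kerF_anti (hsmono hm))).trans le_sup_right
  have h4 : ∀ n, ∀ x ∈ e n, ∀ k ∈ a n ⊔ kerF (sn (n + 1)), ‖x‖ ≤ 4 * ‖x + k‖ := by
    intro n x hx k hk
    obtain ⟨b, hb, w, hw, rfl⟩ := Submodule.mem_sup.1 hk
    have h1 := hnorm n b hb (x + w)
      (Submodule.add_mem _ (hek n hx) (kerF_anti (hsmono (Nat.le_succ n)) hw))
    have h2 := hnorm (n + 1) (b + x) (by
      rw [ha]; exact Submodule.add_mem_sup hb hx) w hw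
    have h3 : b + (x + w) = x + (b + w) := by abel
    have h5 : b + x + w = x + (b + w) := by abel
    rw [h3] at h1
    rw [h5] at h2
    have h6 : ‖x‖ ≤ ‖b + x‖ + ‖b‖ := by
      have := norm_sub_le (b + x) b
      rwa [add_sub_cancel_left] at this
    linarith
  have hbad2 : ∀ n, ∃ F : Submodule ℝ Y, FiniteDimensional ℝ F ∧ e n ≤ F ∧
      ¬ ∃ P : F →ₗ[ℝ] Y, (∀ x, P x ∈ e n) ∧ (∀ x : F, (x : Y) ∈ e n → P x = x) ∧
        ∀ x, ‖P x‖ ≤ (n : ℝ) * ‖x‖ := by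
    intro n
    have := hbad' n
    unfold LocCompl at this
    push Not at this
    obtain ⟨F, h1, h2, h3⟩ := this
    refine ⟨F, h1, h2, ?_⟩
    push Not
    exact h3
  choose F hFfd heF hF using hbad2
  have hZ0 : Z ≠ ⊥ := by
    intro hZ
    have h0 : e 0 = ⊥ := by
      rw [eq_bot_iff, ← hZ]; exact heZ 0
    apply hF 0
    refine ⟨0, ?_, ?_, ?_⟩
    · intro x; simp
    · intro x hx
      rw [h0, Submodule.mem_bot] at hx
      simp [hx]
    · intro x; simp
  have hFg : ∀ n, ∃ t : Finset Y, Submodule.span ℝ (t : Set Y) = F n := by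
    intro n
    have := hFfd n
    exact (Module.Finite.iff_fg.1 this)
  choose t ht using hFg
  obtain ⟨W, T, hZW, hDW, hT⟩ := hY Z (Submodule.isClosed_topologicalClosure _) hZ0
    (⋃ n, (t n : Set Y)) (Set.countable_iUnion fun n => (t n).countable_toSet)
  have hFW : ∀ n, F n ≤ W := by
    intro n
    rw [← ht, Submodule.span_le]
    exact (Set.subset_iUnion (fun n => (t n : Set Y)) n).trans hDW
  obtain ⟨n, hn⟩ := exists_nat_ge (4 * ‖T‖)
  obtain ⟨Q, hQ1, hQ2, hQ3⟩ := exists_proj (e n) (a n ⊔ kerF (sn (n + 1))) 4 (h4 n)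
  apply hF n
  refine ⟨Q ∘ₗ Submodule.inclusion (hZle n) ∘ₗ (T : W →ₗ[ℝ] Z) ∘ₗ Submodule.inclusion (hFW n),
    fun x => hQ1 _, ?_, ?_⟩
  · intro x hx
    refine hQ3 _ _ hx 0 (Submodule.zero_mem _) ?_
    have h1 := hT (Submodule.inclusion (hFW n) x) (heZ n hx)
    simp only [LinearMap.comp_apply, ContinuousLinearMap.coe_coe]
    rw [h1]
    simp
  · intro x
    simp only [LinearMap.comp_apply, ContinuousLinearMap.coe_coe]
    refine (hQ2 _).trans ?_
    have h1 := T.le_opNorm (Submodule.inclusion (hFW n) x)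
    have h2 : ‖Submodule.inclusion (hFW n) x‖ = ‖x‖ := rfl
    have h3 : ‖Submodule.inclusion (hZle n) (T (Submodule.inclusion (hFW n) x))‖
      = ‖T (Submodule.inclusion (hFW n) x)‖ := rfl
    rw [h3]
    rw [h2] at h1
    nlinarith [norm_nonneg x]

end loc

section graph
variable {Y : Type*} [NormedAddCommGroup Y] [NormedSpace ℝ Y]

/-- `E` is `d`-Euclidean. -/
def Euc (d : ℝ) (E : Submodule ℝ Y) : Prop :=
  ∃ m, ∃ T : E →ₗ[ℝ] EU m, ∀ x, ‖x‖ ≤ ‖T x‖ ∧ ‖T x‖ ≤ d * ‖x‖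

lemma euc_combine {V : Type*} [AddCommGroup V] [Module ℝ V] {m₁ m₂ : ℕ} (T₁ : V →ₗ[ℝ] EU m₁)
    (T₂ : V →ₗ[ℝ] EU m₂) (c₁ c₂ : ℝ) :
    ∃ m, ∃ T : V →ₗ[ℝ] EU m, ∀ x,
      ‖T x‖ ^ 2 = 2 * ((c₁ * ‖T₁ x‖) ^ 2 + (c₂ * ‖T₂ x‖) ^ 2) := by
  let r := (stdOrthonormalBasis ℝ (WithLp 2 (EU m₁ × EU m₂))).repr
  refine ⟨_, (√2) • (r.toLinearEquiv.toLinearMap ∘ₗ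
    (WithLp.linearEquiv 2 ℝ (EU m₁ × EU m₂)).symm.toLinearMap ∘ₗ ((c₁ • T₁).prod (c₂ • T₂))), ?_⟩
  intro x
  simp only [LinearMap.smul_apply, norm_smul, mul_pow, LinearMap.comp_apply]
  have h1 : ∀ y, ‖r.toLinearEquiv.toLinearMap y‖ = ‖y‖ := fun y => r.norm_map y
  rw [h1, WithLp.prod_norm_sq_eq_of_L2]
  simp [norm_smul, mul_pow]

lemma euc_of_finite (E : Submodule ℝ Y) [FiniteDimensional ℝ E] : ∃ d, 0 < d ∧ Euc d E := by
  let e : E ≃L[ℝ] EU (Module.finrank ℝ E) := ContinuousLinearEquiv.ofFinrankEq (by simp)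
  refine ⟨(‖(e.symm : EU (Module.finrank ℝ E) →L[ℝ] E)‖ + 1) * (‖(e : E →L[ℝ] EU (Module.finrank ℝ E))‖ + 1), by positivity,
    _, (‖(e.symm : EU (Module.finrank ℝ E) →L[ℝ] E)‖ + 1) • (e.toLinearEquiv.toLinearMap), ?_⟩
  intro x
  have h1 := (e.symm : EU (Module.finrank ℝ E) →L[ℝ] E).le_opNorm (e x)
  have h2 := (e : E →L[ℝ] EU (Module.finrank ℝ E)).le_opNorm x
  simp only [ContinuousLinearEquiv.coe_coe, ContinuousLinearEquiv.symm_apply_apply] at h1 h2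
  rw [LinearMap.smul_apply, norm_smul, Real.norm_of_nonneg (by positivity)]
  have h3 : ‖e.toLinearEquiv.toLinearMap x‖ = ‖e x‖ := rfl
  rw [h3]
  constructor
  · nlinarith [norm_nonneg (e x)]
  · rw [mul_assoc]
    gcongr
    nlinarith [norm_nonneg x]

lemma Euc.mono {d : ℝ} {E F : Submodule ℝ Y} (hF : Euc d F) (h : E ≤ F) : Euc d E := by
  obtain ⟨m, T, hT⟩ := hF
  exact ⟨m, T ∘ₗ Submodule.inclusion h, fun x => hT (Submodule.inclusion h x)⟩

lemma Euc.le {d d' : ℝ} {E : Submodule ℝ Y} (hE : Euc d E) (h : d ≤ d') : Euc d' E := by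
  obtain ⟨m, T, hT⟩ := hE
  exact ⟨m, T, fun x => ⟨(hT x).1, (hT x).2.trans (by gcongr)⟩⟩

lemma graph_step (hY : ¬ FiniteDimensional ℝ Y) (s : Finset (StrongDual ℝ Y)) (lam : ℝ)
    (hlam : 0 < lam) (hs : ∀ E : Submodule ℝ Y, FiniteDimensional ℝ E → E ≤ kerF s → LocCompl lam E)
    (E : Submodule ℝ Y) [FiniteDimensional ℝ E] (hE : E ≤ kerF s) (d : ℝ) (hd : 0 < d)
    (hEd : Euc d E) : Euc (10 * lam * √d) E := by
  classical
  obtain ⟨m, T, hT⟩ := hEd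
  obtain ⟨t, ht⟩ := exists_norming E
  let V := kerF (s ∪ t)
  obtain ⟨S, hS⟩ := dvoretzky (kerF_infinite hY (s ∪ t)) m
  have htV : ∀ x ∈ E, ∀ w ∈ V, ‖x‖ ≤ 2 * ‖x + w‖ := fun x hx w hw =>
    ht x hx w (kerF_anti Finset.subset_union_right hw)
  have hVs : V ≤ kerF s := kerF_anti Finset.subset_union_left
  let S' : EU m →ₗ[ℝ] Y := V.subtype ∘ₗ S
  have hS'V : ∀ a, S' a ∈ V := fun a => (S a).2
  have hS'1 : ∀ a, ‖a‖ ≤ ‖S' a‖ := fun a => (hS a).1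
  have hS'2 : ∀ a, ‖S' a‖ ≤ 3 * ‖a‖ := fun a => (hS a).2
  clear_value S' V
  have hsd : 0 < √d := Real.sqrt_pos.2 hd
  obtain ⟨θ, hθ⟩ : ∃ θ, θ = 1 / √d := ⟨_, rfl⟩
  have hθ0 : 0 < θ := by rw [hθ]; positivity
  let G : Submodule ℝ Y := LinearMap.range (E.subtype + θ • (S' ∘ₗ T))
  have hGmem : ∀ y ∈ G, ∃ x : E, y = x + θ • S' (T x) := by
    rintro y ⟨x, rfl⟩
    exact ⟨x, rfl⟩
  have hGmem' : ∀ x : E, (x : Y) + θ • S' (T x) ∈ G := fun x => ⟨x, rfl⟩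
  have hGfd : FiniteDimensional ℝ G := by infer_instance
  clear_value G
  have hGs : G ≤ kerF s := by
    intro y hy
    obtain ⟨x, rfl⟩ := hGmem y hy
    exact Submodule.add_mem _ (hE x.2) (Submodule.smul_mem _ _ (hVs (hS'V _)))
  let F : Submodule ℝ Y := E ⊔ LinearMap.range S'
  have hEF : E ≤ F := le_sup_left
  have hSF : ∀ a, S' a ∈ F := fun a => (le_sup_right : LinearMap.range S' ≤ F) ⟨a, rfl⟩
  have hFfd : FiniteDimensional ℝ F := by
    show FiniteDimensional ℝ (E ⊔ LinearMap.range S' : Submodule ℝ Y)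
    infer_instance
  clear_value F
  have hGF : G ≤ F := by
    intro y hy
    obtain ⟨x, rfl⟩ := hGmem y hy
    exact Submodule.add_mem _ (hEF x.2) (Submodule.smul_mem _ _ (hSF _))
  obtain ⟨P, hP1, hP2, hP3⟩ := hs G hGfd hGs F hFfd hGF
  obtain ⟨Q, hQ1, hQ2, hQ3⟩ := exists_proj E V 2 htV
  have hGEV : G ≤ E ⊔ V := by
    intro y hy
    obtain ⟨x, rfl⟩ := hGmem y hy
    exact Submodule.add_mem_sup x.2 (Submodule.smul_mem _ _ (hS'V _))
  let R : F →ₗ[ℝ] E := LinearMap.codRestrict E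
    (Q ∘ₗ LinearMap.codRestrict (E ⊔ V) P (fun x => hGEV (hP1 x))) (fun x => hQ1 _)
  have hR1 : ∀ y, ‖R y‖ ≤ 2 * lam * ‖y‖ := by
    intro y
    have h1 : ‖R y‖ ≤ 2 * ‖P y‖ := hQ2 _
    have := hP3 y
    linarith
  have hR2 : ∀ y, P y = R y + θ • S' (T (R y)) := by
    intro y
    obtain ⟨x, hx⟩ := hGmem _ (hP1 y)
    have h1 : ((R y : E) : Y) = x :=
      hQ3 _ _ x.2 _ (Submodule.smul_mem _ θ (hS'V (T x))) hx
    have h2 : R y = x := Subtype.ext h1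
    rw [h2, hx]
  clear_value R
  let A : E →ₗ[ℝ] E := R ∘ₗ Submodule.inclusion hEF
  have hu : ∀ x : E, ‖T (A x)‖ ≤ 3 * lam * √d * ‖x‖ := by
    intro x
    have h1 := hR2 (Submodule.inclusion hEF x)
    have h2 := hP3 (Submodule.inclusion hEF x)
    have h3 := hR1 (Submodule.inclusion hEF x)
    have h4 : ‖Submodule.inclusion hEF x‖ = ‖x‖ := rfl
    have h5 : θ • S' (T (A x)) = P (Submodule.inclusion hEF x) - (A x : Y) := by
      rw [h1]; simp [A]
    have h6 : θ * ‖S' (T (A x))‖ ≤ 3 * lam * ‖x‖ := by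
      rw [← Real.norm_of_nonneg hθ0.le, ← norm_smul, h5]
      refine (norm_sub_le _ _).trans ?_
      have : ‖(A x : Y)‖ ≤ 2 * lam * ‖x‖ := h3
      rw [h4] at h2
      linarith
    have h7 := hS'1 (T (A x))
    rw [hθ, one_div, inv_mul_le_iff₀ hsd] at h6
    linarith
  have hv : ∀ x : E, ‖x‖ ≤ ‖T (A x)‖ + 6 * lam * θ * ‖T x‖ := by
    intro x
    let b : F := ⟨S' (T x), hSF _⟩
    have h1 : P (Submodule.inclusion hEF x + θ • b) = x + θ • S' (T x) :=
      hP2 _ (hGmem' x)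
    have h2 : R (Submodule.inclusion hEF x + θ • b) = x := by
      rw [hR2] at h1
      have h3 := htV ((R (Submodule.inclusion hEF x + θ • b) - x : E) : Y) (Submodule.coe_mem _)
        (θ • S' (T (R (Submodule.inclusion hEF x + θ • b))) - θ • S' (T x))
        (Submodule.sub_mem _ (Submodule.smul_mem _ _ (hS'V _)) (Submodule.smul_mem _ _ (hS'V _)))
      have h4 : ((R (Submodule.inclusion hEF x + θ • b) - x : E) : Y) +
        (θ • S' (T (R (Submodule.inclusion hEF x + θ • b))) - θ • S' (T x)) = 0 := by
        rw [Submodule.coe_sub, sub_add_sub_comm, h1, sub_self]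
      rw [h4, norm_zero, mul_zero] at h3
      have h5 := norm_le_zero_iff.1 h3
      exact sub_eq_zero.1 (Subtype.ext h5)
    have h3 : x = A x + θ • R b := by
      conv_lhs => rw [← h2]
      simp [A]
    have h4 : ‖R b‖ ≤ 6 * lam * ‖T x‖ := by
      have h5 := hR1 b
      have h6 : ‖b‖ ≤ 3 * ‖T x‖ := hS'2 _
      calc ‖R b‖ ≤ 2 * lam * ‖b‖ := h5
        _ ≤ 2 * lam * (3 * ‖T x‖) := by gcongr
        _ = _ := by ring
    calc ‖x‖ ≤ ‖A x‖ + ‖θ • R b‖ := by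
          conv_lhs => rw [h3]
          exact norm_add_le _ _
      _ ≤ ‖T (A x)‖ + θ * (6 * lam * ‖T x‖) := by
          rw [norm_smul, Real.norm_of_nonneg hθ0.le]
          have := (hT (A x)).1
          gcongr
      _ = _ := by ring
  obtain ⟨m', T', hT'⟩ := euc_combine (T ∘ₗ A) T 1 (6 * lam * θ)
  refine ⟨m', T', fun x => ?_⟩
  have h1 := hT' x
  rw [LinearMap.comp_apply, one_mul] at h1
  have hw : 6 * lam * θ * ‖T x‖ ≤ 6 * lam * √d * ‖x‖ := by
    have h2 := (hT x).2
    have h3 : θ * d = √d := by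
      rw [hθ]
      field_simp
      exact (Real.sq_sqrt hd.le).symm
    calc 6 * lam * θ * ‖T x‖ ≤ 6 * lam * θ * (d * ‖x‖) := by gcongr
      _ = 6 * lam * (θ * d) * ‖x‖ := by ring
      _ = _ := by rw [h3]
  have hu := hu x
  have hv := hv x
  have hw0 : 0 ≤ 6 * lam * θ * ‖T x‖ := by positivity
  generalize 6 * lam * θ * ‖T x‖ = v at *
  have hu0 := norm_nonneg (T (A x))
  generalize ‖T (A x)‖ = u at *
  constructor
  · refine le_of_sq_le_sq ?_ (norm_nonneg _)
    rw [h1]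
    nlinarith [sq_nonneg (u - v), norm_nonneg x]
  · have hL : 0 ≤ lam * √d * ‖x‖ := by positivity
    refine le_of_sq_le_sq ?_ (by positivity)
    rw [h1]
    have e1 : 3 * lam * √d * ‖x‖ = 3 * (lam * √d * ‖x‖) := by ring
    have e2 : 6 * lam * √d * ‖x‖ = 6 * (lam * √d * ‖x‖) := by ring
    have e3 : 10 * lam * √d * ‖x‖ = 10 * (lam * √d * ‖x‖) := by ring
    rw [e1] at hu
    rw [e2] at hw
    rw [e3]
    generalize lam * √d * ‖x‖ = L at *
    have := pow_le_pow_left₀ hu0 hu 2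
    have := pow_le_pow_left₀ hw0 hw 2
    nlinarith [sq_nonneg L]

lemma euc_uniform_ker (hY : ¬ FiniteDimensional ℝ Y) (s : Finset (StrongDual ℝ Y)) (lam : ℝ)
    (hlam : 0 < lam) (hs : ∀ E : Submodule ℝ Y, FiniteDimensional ℝ E → E ≤ kerF s → LocCompl lam E)
    (E : Submodule ℝ Y) [FiniteDimensional ℝ E] (hE : E ≤ kerF s) :
    Euc (4 * (10 * lam) ^ 2) E := by
  let I : Set ℝ := {d | 0 < d ∧ Euc d E}
  obtain ⟨d0, hd0, hE0⟩ := euc_of_finite E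
  have hne : I.Nonempty := ⟨d0, hd0, hE0⟩
  have hbdd : BddBelow I := ⟨0, fun d hd => hd.1.le⟩
  by_contra hcon
  have hall : ∀ d ∈ I, 4 * (10 * lam) ^ 2 < d := by
    intro d hd
    by_contra h
    exact hcon (hd.2.le (not_lt.1 h))
  have hi : 4 * (10 * lam) ^ 2 ≤ sInf I := le_csInf hne fun d hd => (hall d hd).le
  have hpos : 0 < sInf I := lt_of_lt_of_le (by positivity) hi
  obtain ⟨d, hd, hdi⟩ := exists_lt_of_csInf_lt hne (show sInf I < 2 * sInf I by linarith)
  have h1 := hall d hd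
  have hsd : 0 < √d := Real.sqrt_pos.2 hd.1
  have hsq : √d ^ 2 = d := Real.sq_sqrt hd.1.le
  have h2 : 2 * (10 * lam) < √d := by
    refine lt_of_pow_lt_pow_left₀ 2 hsd.le ?_
    rw [hsq]; linarith
  have h3 : 10 * lam * √d ∈ I :=
    ⟨by positivity, graph_step hY s lam hlam hs E hE d hd.1 hd.2⟩
  have h4 := csInf_le hbdd h3
  nlinarith

end graph

section unif
variable {Y : Type*} [NormedAddCommGroup Y] [NormedSpace ℝ Y]

lemma finite_quot_kerF (s : Finset (StrongDual ℝ Y)) : FiniteDimensional ℝ (Y ⧸ kerF s) :=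
  FiniteDimensional.of_injective
    ((LinearMap.pi fun φ : s => (φ.1 : Y →ₗ[ℝ] ℝ)).quotKerEquivRange.toLinearMap)
    (LinearEquiv.injective _)

theorem euc_uniform (hY : SepCompl Y) :
    ∃ D : ℝ, 0 < D ∧ ∀ E : Submodule ℝ Y, FiniteDimensional ℝ E → Euc D E := by
  by_cases hfd : FiniteDimensional ℝ Y
  · obtain ⟨D, hD, hT⟩ := euc_of_finite (⊤ : Submodule ℝ Y)
    exact ⟨D, hD, fun E _ => hT.mono le_top⟩
  obtain ⟨s, n, hs⟩ := exists_locCompl hY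
  have hs' : ∀ E : Submodule ℝ Y, FiniteDimensional ℝ E → E ≤ kerF s →
      LocCompl ((n : ℝ) + 1) E := by
    intro E hE hEs F hF hEF
    obtain ⟨P, h1, h2, h3⟩ := hs E hE hEs F hF hEF
    exact ⟨P, h1, h2, fun x => (h3 x).trans (by nlinarith [norm_nonneg x])⟩
  have hD1 := euc_uniform_ker hfd s ((n : ℝ) + 1) (by positivity) hs'
  obtain ⟨D₁, hD₁⟩ : ∃ D₁, D₁ = 4 * (10 * ((n : ℝ) + 1)) ^ 2 := ⟨_, rfl⟩
  have hD₁0 : 0 < D₁ := by rw [hD₁]; positivity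
  rw [← hD₁] at hD1
  have := finite_quot_kerF s
  obtain ⟨p, hp⟩ := Submodule.ClosedComplemented.of_finiteDimensional_quotient (isClosed_kerF s)
  let N : Submodule ℝ Y := LinearMap.ker (p : Y →ₗ[ℝ] kerF s)
  have hNfd : FiniteDimensional ℝ N := by
    refine FiniteDimensional.of_injective ((kerF s).mkQ ∘ₗ N.subtype) ?_
    rw [← LinearMap.ker_eq_bot, LinearMap.ker_eq_bot']
    intro x hx
    have h1 : (x : Y) ∈ kerF s := by simpa using hx
    have h2 := hp ⟨x, h1⟩
    have h3 : p x = 0 := x.2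
    simp only at h2
    rw [h3] at h2
    apply Subtype.ext
    exact (congrArg Subtype.val h2).symm
  obtain ⟨D₂, hD₂0, m₂, T₂, hT₂⟩ := euc_of_finite N
  let q : Y →ₗ[ℝ] N := LinearMap.codRestrict N
    (LinearMap.id - (kerF s).subtype ∘ₗ (p : Y →ₗ[ℝ] kerF s)) (by
      intro x
      simp only [N, LinearMap.mem_ker]
      simp [hp])
  have hq : ∀ x, x = p x + (q x : Y) := by
    intro x; simp [q]
  clear_value q
  refine ⟨2 * (D₁ * ‖p‖ + D₂ * (1 + ‖p‖)), by positivity, ?_⟩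
  intro E hE
  let E₁ : Submodule ℝ Y := E.map ((kerF s).subtype ∘ₗ (p : Y →ₗ[ℝ] kerF s))
  have hE₁ : E₁ ≤ kerF s := by
    rintro y ⟨x, -, rfl⟩
    exact (p x).2
  obtain ⟨m₁, T₁, hT₁⟩ := hD1 E₁ hE₁
  let j : E →ₗ[ℝ] E₁ := LinearMap.submoduleMap _ E
  have hj : ∀ x : E, (j x : Y) = p x := fun x => rfl
  obtain ⟨m, T, hT⟩ := euc_combine (T₁ ∘ₗ j) (T₂ ∘ₗ q ∘ₗ E.subtype) 1 1
  refine ⟨m, T, fun x => ?_⟩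
  have h1 := hT x
  simp only [LinearMap.comp_apply, one_mul, Submodule.subtype_apply] at h1
  obtain ⟨a1, a2⟩ := hT₁ (j x)
  obtain ⟨b1, b2⟩ := hT₂ (q x)
  have hpx := p.le_opNorm (x : Y)
  have hjx : ‖j x‖ = ‖p x‖ := by
    show ‖(j x : Y)‖ = ‖(p x : Y)‖
    rw [hj]
  have hxx : ‖(x : Y)‖ = ‖x‖ := rfl
  have hqx : ‖q x‖ ≤ (1 + ‖p‖) * ‖x‖ := by
    have h2 : (q x : Y) = x - (p x : Y) := by
      have := hq x
      exact (sub_eq_of_eq_add' this).symm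
    show ‖(q x : Y)‖ ≤ _
    rw [h2]
    refine (norm_sub_le _ _).trans ?_
    have : ‖(p x : Y)‖ = ‖p x‖ := rfl
    rw [this, hxx]
    rw [hxx] at hpx
    linarith
  have hx2 : ‖x‖ ≤ ‖j x‖ + ‖q x‖ := by
    rw [hjx, ← hxx]
    conv_lhs => rw [hq x]
    exact norm_add_le _ _
  rw [hxx, ← hjx] at hpx
  have hu : ‖T₁ (j x)‖ ≤ D₁ * ‖p‖ * ‖x‖ := a2.trans (by rw [mul_assoc]; gcongr)
  have hv : ‖T₂ (q x)‖ ≤ D₂ * (1 + ‖p‖) * ‖x‖ := b2.trans (by rw [mul_assoc]; gcongr)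
  have hu0 := norm_nonneg (T₁ (j x))
  have hv0 := norm_nonneg (T₂ (q x))
  have hx0 := norm_nonneg x
  have hT0 := norm_nonneg (T x)
  have hxuv : ‖x‖ ≤ ‖T₁ (j x)‖ + ‖T₂ (q x)‖ := by linarith
  generalize ‖T₁ (j x)‖ = u at *
  generalize ‖T₂ (q x)‖ = v at *
  constructor
  · refine le_of_sq_le_sq ?_ hT0
    rw [h1]
    nlinarith [sq_nonneg (u - v)]
  · have h5 : ‖T x‖ ≤ 2 * (u + v) := by
      refine le_of_sq_le_sq ?_ (by positivity)
      rw [h1]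
      nlinarith [mul_nonneg hu0 hv0]
    refine h5.trans ?_
    linarith

end unif

/-- Limit bilinear form. -/
theorem exists_form {Y : Type*} [NormedAddCommGroup Y] [NormedSpace ℝ Y] (D : ℝ) (hD : 0 < D)
    (hE : ∀ E : Submodule ℝ Y, FiniteDimensional ℝ E → Euc D E) :
    ∃ b : Y → Y → ℝ, (∀ x y, b x y = b y x) ∧ (∀ x y z, b (x + y) z = b x z + b y z) ∧
      (∀ (c : ℝ) x y, b (c • x) y = c * b x y) ∧ (∀ x, ‖x‖ ^ 2 ≤ b x x) ∧
      (∀ x, b x x ≤ (D * ‖x‖) ^ 2) := by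
  classical
  let Et : Finset Y → Submodule ℝ Y := fun t => Submodule.span ℝ (t : Set Y)
  have hfd : ∀ t, FiniteDimensional ℝ (Et t) := fun t => FiniteDimensional.span_finset ℝ t
  choose m T hT using fun t => hE (Et t) (hfd t)
  let B : Y → Y → Finset Y → ℝ := fun x y t =>
    if h : x ∈ Et t ∧ y ∈ Et t then inner ℝ (T t ⟨x, h.1⟩) (T t ⟨y, h.2⟩) else 0
  have hB : ∀ t x y (hx : x ∈ Et t) (hy : y ∈ Et t),
      B x y t = inner ℝ (T t ⟨x, hx⟩) (T t ⟨y, hy⟩) := by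
    intro t x y hx hy
    simp only [B]
    rw [dif_pos ⟨hx, hy⟩]
  have hbd : ∀ x y t, B x y t ∈ Set.Icc (-((D * ‖x‖) * (D * ‖y‖))) ((D * ‖x‖) * (D * ‖y‖)) := by
    intro x y t
    rw [Set.mem_Icc, ← abs_le]
    by_cases h : x ∈ Et t ∧ y ∈ Et t
    · rw [hB t x y h.1 h.2]
      refine (abs_real_inner_le_norm _ _).trans ?_
      have h1 := (hT t ⟨x, h.1⟩).2
      have h2 := (hT t ⟨y, h.2⟩).2
      simp only [Submodule.coe_norm] at h1 h2
      gcongr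
    · simp only [B]
      rw [dif_neg h, abs_zero]
      positivity
  let U : Ultrafilter (Finset Y) := Ultrafilter.of atTop
  have hU : (U : Filter (Finset Y)) ≤ atTop := Ultrafilter.of_le _
  have hlim : ∀ x y, ∃ l, Tendsto (B x y) U (𝓝 l) := by
    intro x y
    obtain ⟨l, -, hl⟩ := isCompact_Icc.ultrafilter_le_nhds (U.map (B x y))
      (by
        rw [Filter.le_principal_iff]
        exact Filter.mem_map.2 (Filter.univ_mem' (hbd x y)))
    exact ⟨l, hl⟩
  choose b hb using hlim
  have hmem : ∀ x, ∀ᶠ t in (U : Filter (Finset Y)), x ∈ Et t := by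
    intro x
    refine hU ((eventually_ge_atTop {x}).mono ?_)
    intro t ht
    exact Submodule.subset_span (ht (Finset.mem_singleton_self x))
  refine ⟨b, ?_, ?_, ?_, ?_, ?_⟩
  · intro x y
    refine tendsto_nhds_unique_of_eventuallyEq (hb x y) (hb y x) ?_
    filter_upwards [hmem x, hmem y] with t hx hy
    rw [hB t x y hx hy, hB t y x hy hx, real_inner_comm]
  · intro x y z
    refine tendsto_nhds_unique_of_eventuallyEq (hb (x + y) z) ((hb x z).add (hb y z)) ?_
    filter_upwards [hmem x, hmem y, hmem z] with t hx hy hz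
    rw [hB t x z hx hz, hB t y z hy hz, hB t (x + y) z ((Et t).add_mem hx hy) hz,
      ← inner_add_left, ← map_add]
    rfl
  · intro c x y
    refine tendsto_nhds_unique_of_eventuallyEq (hb (c • x) y) ((hb x y).const_mul c) ?_
    filter_upwards [hmem x, hmem y] with t hx hy
    rw [hB t x y hx hy, hB t (c • x) y ((Et t).smul_mem c hx) hy, ← real_inner_smul_left,
      ← map_smul]
    rfl
  · intro x
    refine ge_of_tendsto (hb x x) ?_
    filter_upwards [hmem x] with t hx
    rw [hB t x x hx hx, real_inner_self_eq_norm_sq]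
    have := (hT t ⟨x, hx⟩).1
    simp only [Submodule.coe_norm] at this
    gcongr
  · intro x
    refine le_of_tendsto (hb x x) ?_
    filter_upwards [hmem x] with t hx
    have := (hbd x x t).2
    rwa [← sq] at this

/-- Type synonym carrying the Hilbert structure. -/
def HilbSyn (Y : Type*) : Type _ := Y

instance (Y : Type*) [NormedAddCommGroup Y] : AddCommGroup (HilbSyn Y) :=
  inferInstanceAs (AddCommGroup Y)

instance (Y : Type*) [NormedAddCommGroup Y] [NormedSpace ℝ Y] : Module ℝ (HilbSyn Y) :=
  inferInstanceAs (Module ℝ Y)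

theorem hilbert_of_core {Y H : Type u} [NormedAddCommGroup Y] [NormedSpace ℝ Y] [CompleteSpace Y]
    [AddCommGroup H] [Module ℝ H] (e : Y ≃ₗ[ℝ] H) (cd : InnerProductSpace.Core ℝ H) (D : ℝ)
    (hD : 0 < D)
    (h1 : ∀ x : Y, ‖x‖ ^ 2 ≤ cd.inner (e x) (e x))
    (h2 : ∀ x : Y, cd.inner (e x) (e x) ≤ (D * ‖x‖) ^ 2) :
    ∃ (H : Type u) (_ : NormedAddCommGroup H) (_ : InnerProductSpace ℝ H) (_ : CompleteSpace H),
      Nonempty (Y ≃L[ℝ] H) := by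
  let i1 : NormedAddCommGroup H := @InnerProductSpace.Core.toNormedAddCommGroup ℝ H _ _ _ cd
  let i2 : InnerProductSpace ℝ H := InnerProductSpace.ofCore cd.toCore
  have hn : ∀ y : H, ‖y‖ ^ 2 = cd.inner y y := fun y => by
    exact (real_inner_self_eq_norm_sq y).symm
  let E : Y ≃L[ℝ] H := e.toContinuousLinearEquivOfBounds D 1 (by
    intro x
    refine le_of_sq_le_sq ?_ (by positivity)
    rw [hn]; exact h2 x) (by
    intro y
    rw [one_mul]
    refine le_of_sq_le_sq ?_ (norm_nonneg _)
    have := h1 (e.symm y)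
    rwa [e.apply_symm_apply, ← hn] at this)
  have hc : CompleteSpace H := (completeSpace_congr (e := E.toEquiv) E.isUniformEmbedding).1 inferInstance
  exact ⟨H, i1, i2, hc, ⟨E⟩⟩

/-- If `Y` is universally right-stable, then `Y` is isomorphic to a Hilbert space. -/
theorem stmt2 {Y : Type u} [NormedAddCommGroup Y] [NormedSpace ℝ Y] [CompleteSpace Y]
    (h : ∀ (X : Type u) [NormedAddCommGroup X] [NormedSpace ℝ X] [CompleteSpace X],
      PairStable X Y) :
    ∃ (H : Type u) (_ : NormedAddCommGroup H) (_ : InnerProductSpace ℝ H) (_ : CompleteSpace H),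
      Nonempty (Y ≃L[ℝ] H) := by
  obtain ⟨D, hD, hE⟩ := euc_uniform (sepCompl_of_stable h)
  obtain ⟨b, hsymm, hadd, hsmul, hlow, hup⟩ := exists_form D hD hE
  let cd : InnerProductSpace.Core ℝ (HilbSyn Y) :=
    { inner := fun x y => b x y
      conj_inner_symm := fun x y => hsymm y x
      re_inner_nonneg := fun x => (sq_nonneg _).trans (hlow x)
      add_left := fun x y z => hadd x y z
      smul_left := fun x y r => hsmul r x y
      definite := fun x hx => by
        have h1 := hlow x
        rw [show b x x = 0 from hx] at h1
        exact norm_eq_zero.1 (pow_eq_zero_iff two_ne_zero |>.1 (le_antisymm h1 (sq_nonneg _))) }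
  exact hilbert_of_core (LinearEquiv.refl ℝ Y : Y ≃ₗ[ℝ] HilbSyn Y) cd D hD hlow hup
end
end

section
/- Let X be a real Banach space that is both universally left-stable and universally right-stable. Then X is finite dimensional. -/
open scoped ENNReal ZeroAtInfty

noncomputable section

abbrev Winf := BoundedContinuousFunction ℕ ℝ

/-- A lattice seminorm on `ℓ∞` which is additive on the positive cone. -/
structure PosF (N : Winf → ℝ) : Prop where
  mono : ∀ f g : Winf, (∀ n, |f n| ≤ |g n|) → N f ≤ N g
  add : ∀ f g : Winf, (∀ n, 0 ≤ f n) → (∀ n, 0 ≤ g n) → N (f + g) = N f + N g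
  smul : ∀ (c : ℝ) (f : Winf), 0 ≤ c → N (c • f) = c * N f

theorem winf_norm_le_iff {f : Winf} {C : ℝ} (hC : 0 ≤ C) : ‖f‖ ≤ C ↔ ∀ n, |f n| ≤ C :=
  BoundedContinuousFunction.norm_le hC

theorem winf_abs_le (f : Winf) (n : ℕ) : |f n| ≤ ‖f‖ := f.norm_coe_le_norm n

theorem winf_smul_sub (c : ℝ) (f g : Winf) : c • f - c • g = c • (f - g) := by
  ext n; simp; ring

theorem winf_smul_mul (c : ℝ) (f g : Winf) : (c • f) * g = c • (f * g) := by
  ext n; simp; ring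

theorem winf_mul_smul (c : ℝ) (f g : Winf) : f * (c • g) = c • (f * g) := by
  ext n; simp; ring

theorem PosF.zero {N : Winf → ℝ} (h : PosF N) : N 0 = 0 := by
  have := h.smul 0 0 le_rfl
  simpa using this

theorem PosF.nonneg {N : Winf → ℝ} (h : PosF N) (f : Winf) : 0 ≤ N f := by
  rw [← h.zero]
  exact h.mono _ _ (fun n => by simp)

theorem dominate (φ : Winf →L[ℝ] ℝ) :
    ∃ N : Winf → ℝ, PosF N ∧ (∀ f, |φ f| ≤ N f) ∧ ∀ f, N f ≤ ‖φ‖ * ‖f‖ := by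
  let S : Winf → Set ℝ := fun f => φ '' {g | ∀ n, |g n| ≤ |f n|}
  have hle : ∀ f, ∀ r ∈ S f, r ≤ ‖φ‖ * ‖f‖ := by
    rintro f r ⟨g, hg, rfl⟩
    refine (le_abs_self _).trans ((φ.le_opNorm g).trans ?_)
    gcongr
    rw [winf_norm_le_iff (norm_nonneg _)]
    exact fun n => (hg n).trans (winf_abs_le f n)
  have hbdd : ∀ f, BddAbove (S f) := fun f => ⟨_, hle f⟩
  have hne : ∀ f, (S f).Nonempty := fun f => ⟨φ f, f, fun n => le_rfl, rfl⟩
  have hmem : ∀ f g : Winf, (∀ n, |g n| ≤ |f n|) → φ g ≤ sSup (S f) := fun f g hg =>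
    le_csSup (hbdd f) ⟨g, hg, rfl⟩
  have hsm : ∀ (c : ℝ) (f : Winf), 0 ≤ c → c * sSup (S f) ≤ sSup (S (c • f)) := by
    intro c f hc
    rcases hc.eq_or_lt with rfl | hc
    · have := hmem ((0 : ℝ) • f) 0 (by simp)
      simpa using this
    · rw [← le_div_iff₀' hc]
      refine csSup_le (hne f) ?_
      rintro r ⟨g, hg, rfl⟩
      rw [le_div_iff₀' hc]
      have := hmem (c • f) (c • g) (fun n => by
        simp only [BoundedContinuousFunction.coe_smul, smul_eq_mul, abs_mul]
        exact mul_le_mul_of_nonneg_left (hg n) (abs_nonneg c))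
      simpa using this
  refine ⟨fun f => sSup (S f), ⟨?_, ?_, ?_⟩, ?_, ?_⟩
  · intro f g hfg
    refine csSup_le (hne f) ?_
    rintro r ⟨k, hk, rfl⟩
    exact hmem _ _ (fun n => (hk n).trans (hfg n))
  · intro f g hf hg
    apply le_antisymm
    · refine csSup_le (hne _) ?_
      rintro r ⟨k, hk, rfl⟩
      let k1 : Winf := (k ⊓ f) ⊔ (-f)
      have e : k = k1 + (k - k1) := by abel
      rw [e, map_add]
      have hk1 : ∀ n, k1 n = max (min (k n) (f n)) (-(f n)) := fun n => by simp [k1]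
      refine add_le_add (hmem _ _ fun n => ?_) (hmem _ _ fun n => ?_)
      · rw [hk1, abs_of_nonneg (hf n), abs_le]
        have := hf n
        constructor
        · exact le_max_right _ _
        · exact max_le (min_le_right _ _) (by linarith)
      · have h1 := hk n
        simp only [BoundedContinuousFunction.coe_add, Pi.add_apply,
          BoundedContinuousFunction.coe_sub, Pi.sub_apply, hk1] at h1 ⊢
        have h2 := hf n
        have h3 := hg n
        rw [abs_of_nonneg (add_nonneg h2 h3), abs_le] at h1
        rw [abs_of_nonneg h3, abs_le]
        rcases le_total (k n) (f n) with h | h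
        · rw [min_eq_left h]
          rcases le_total (k n) (-(f n)) with h' | h'
          · rw [max_eq_right h']; constructor <;> linarith
          · rw [max_eq_left h']; constructor <;> linarith
        · rw [min_eq_right h, max_eq_left (by linarith)]; constructor <;> linarith
    · have : ∀ r ∈ S f, r ≤ sSup (S (f + g)) - sSup (S g) := by
        rintro r ⟨k, hk, rfl⟩
        have : ∀ r ∈ S g, r ≤ sSup (S (f + g)) - φ k := by
          rintro r ⟨l, hl, rfl⟩
          have := hmem (f + g) (k + l) (fun n => by
            have h1 := hk n
            have h2 := hl n
            simp only [BoundedContinuousFunction.coe_add, Pi.add_apply]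
            rw [abs_of_nonneg (hf n)] at h1
            rw [abs_of_nonneg (hg n)] at h2
            rw [abs_of_nonneg (add_nonneg (hf n) (hg n))]
            exact (abs_add_le _ _).trans (add_le_add h1 h2))
          rw [map_add] at this
          linarith
        have := csSup_le (hne g) this
        linarith
      have := csSup_le (hne f) this
      linarith
  · intro c f hc
    refine le_antisymm ?_ (hsm c f hc)
    rcases hc.eq_or_lt with rfl | hc
    · refine csSup_le (hne _) ?_
      intro r hr
      have := hle _ r hr
      simpa using this
    · have := hsm c⁻¹ (c • f) (by positivity)
      rw [smul_smul, inv_mul_cancel₀ hc.ne', one_smul, inv_mul_le_iff₀ hc] at this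
      exact this
  · intro f
    rw [abs_le]
    constructor
    · have := hmem f (-f) (by simp)
      rw [map_neg] at this
      linarith
    · exact hmem f f (fun n => le_rfl)
  · intro f
    exact csSup_le (hne f) (hle f)

theorem PosF.exists_linear {N : Winf → ℝ} (h : PosF N) :
    ∃ ν : Winf →ₗ[ℝ] ℝ, ∀ f : Winf, (∀ n, 0 ≤ f n) → ν f = N f := by
  have key : ∀ a b c d : Winf, (∀ n, 0 ≤ a n) → (∀ n, 0 ≤ b n) → (∀ n, 0 ≤ c n) →
      (∀ n, 0 ≤ d n) → a - b = c - d → N a - N b = N c - N d := by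
    intro a b c d ha hb hc hd e
    have e' : a + d = c + b := by
      rw [sub_eq_sub_iff_add_eq_add] at e; exact e
    have h1 := h.add a d ha hd
    have h2 := h.add c b hc hb
    rw [e'] at h1
    linarith
  have hp : ∀ (f : Winf) n, 0 ≤ (f ⊔ 0) n := fun f n => by simp
  have hm : ∀ (f : Winf) n, 0 ≤ ((-f) ⊔ 0) n := fun f n => by simp
  have hpm : ∀ f : Winf, (f ⊔ 0) - ((-f) ⊔ 0) = f := by
    intro f
    ext n
    simp only [BoundedContinuousFunction.coe_sub, Pi.sub_apply, BoundedContinuousFunction.coe_sup,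
      Pi.sup_apply, BoundedContinuousFunction.coe_neg, Pi.neg_apply,
      BoundedContinuousFunction.coe_zero, Pi.zero_apply]
    rcases le_total (f n) 0 with h | h
    · rw [sup_eq_right.2 h, sup_eq_left.2 (by linarith)]; ring
    · rw [sup_eq_left.2 h, sup_eq_right.2 (by linarith)]; ring
  have hsm : ∀ (c : ℝ) (f : Winf), 0 ≤ c → (∀ n, 0 ≤ f n) → ∀ n, 0 ≤ (c • f) n := by
    intro c f hc hf n
    simpa using mul_nonneg hc (hf n)
  have had : ∀ (f g : Winf), (∀ n, 0 ≤ f n) → (∀ n, 0 ≤ g n) → ∀ n, 0 ≤ (f + g) n := by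
    intro f g hf hg n
    simpa using add_nonneg (hf n) (hg n)
  refine ⟨{ toFun := fun f => N (f ⊔ 0) - N ((-f) ⊔ 0), map_add' := ?_, map_smul' := ?_ }, ?_⟩
  · intro f g
    have := key ((f + g) ⊔ 0) ((-(f + g)) ⊔ 0) (f ⊔ 0 + g ⊔ 0) ((-f) ⊔ 0 + (-g) ⊔ 0) (hp _) (hm _)
      (had _ _ (hp _) (hp _)) (had _ _ (hm _) (hm _)) (by
        rw [hpm, add_sub_add_comm, hpm, hpm])
    rw [this, h.add _ _ (hp _) (hp _), h.add _ _ (hm _) (hm _)]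
    ring
  · intro c f
    simp only [RingHom.id_apply, smul_eq_mul]
    rcases le_total 0 c with hc | hc
    · have := key ((c • f) ⊔ 0) ((-(c • f)) ⊔ 0) (c • (f ⊔ 0)) (c • ((-f) ⊔ 0)) (hp _) (hm _)
        (hsm _ _ hc (hp _)) (hsm _ _ hc (hm _)) (by rw [hpm, winf_smul_sub, hpm])
      rw [this, h.smul _ _ hc, h.smul _ _ hc]
      ring
    · have hc' : 0 ≤ -c := by linarith
      have := key ((c • f) ⊔ 0) ((-(c • f)) ⊔ 0) ((-c) • ((-f) ⊔ 0)) ((-c) • (f ⊔ 0)) (hp _) (hm _)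
        (hsm _ _ hc' (hm _)) (hsm _ _ hc' (hp _)) (by
          rw [hpm, winf_smul_sub, ← neg_sub, hpm]; simp)
      rw [this, h.smul _ _ hc', h.smul _ _ hc']
      ring
  · intro f hf
    have := key (f ⊔ 0) ((-f) ⊔ 0) f 0 (hp _) (hm _) hf (fun n => le_rfl) (by rw [hpm, sub_zero])
    simp only [LinearMap.coe_mk, AddHom.coe_mk]
    rw [this, h.zero, sub_zero]

/-- Grothendieck's argument. -/
theorem finrank_bound {N : Winf → ℝ} (h : PosF N) (K : ℝ) (hK : 0 < K) (V : Submodule ℝ Winf)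
    [FiniteDimensional ℝ V] (hV : ∀ w ∈ V, ‖w‖ ≤ K * N w) :
    (Module.finrank ℝ V : ℝ) ≤ K ^ 2 * N 1 * N 1 := by
  obtain ⟨ν, hν⟩ := h.exists_linear
  let B : LinearMap.BilinForm ℝ V := LinearMap.mk₂ ℝ (fun f g => ν ((f : Winf) * (g : Winf)))
    (fun a b c => by simp [add_mul]) (fun c a b => by simp [winf_smul_mul])
    (fun a b c => by simp [mul_add]) (fun c a b => by simp [winf_mul_smul])
  have hB : ∀ f g : V, B f g = ν ((f : Winf) * (g : Winf)) := fun f g => rfl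
  have hsymm : LinearMap.IsSymm B := ⟨fun f g => by simp [hB, mul_comm]⟩
  have hsq : ∀ (f : Winf) n, 0 ≤ (f * f) n := fun f n => by
    simpa using mul_self_nonneg (f n)
  -- basic inequality
  have hbasic : ∀ w ∈ V, ‖w‖ ≤ ν (w * w) / 2 + K ^ 2 * N 1 / 2 := by
    intro w hw
    have h1 : N w ≤ N ((1 / (2 * K)) • (w * w) + (K / 2) • (1 : Winf)) := by
      apply h.mono
      intro n
      refine le_trans ?_ (le_abs_self _)
      simp only [BoundedContinuousFunction.coe_add, Pi.add_apply, BoundedContinuousFunction.coe_smul,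
        BoundedContinuousFunction.coe_mul, Pi.mul_apply, BoundedContinuousFunction.coe_one,
        Pi.one_apply, smul_eq_mul, mul_one]
      rw [← abs_mul_abs_self (w n)]
      have : 1 / (2 * K) * (|w n| * |w n|) + K / 2 - |w n| = (|w n| - K) ^ 2 / (2 * K) := by
        field_simp; ring
      have : 0 ≤ (|w n| - K) ^ 2 / (2 * K) := by positivity
      linarith
    rw [h.add, h.smul _ _ (by positivity), h.smul _ _ (by positivity), ← hν _ (hsq w)] at h1
    · calc ‖w‖ ≤ K * N w := hV w hw
        _ ≤ K * (1 / (2 * K) * ν (w * w) + K / 2 * N 1) := by gcongr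
        _ = _ := by field_simp
    · intro n
      have := hsq w n
      simp only [BoundedContinuousFunction.coe_smul, smul_eq_mul]
      positivity
    · intro n
      simp only [BoundedContinuousFunction.coe_smul, smul_eq_mul, BoundedContinuousFunction.coe_one,
        Pi.one_apply]
      positivity
  have hpos : ∀ f : V, f ≠ 0 → 0 < B f f := by
    intro f hf
    rw [hB, hν _ (hsq _)]
    refine lt_of_le_of_ne (h.nonneg _) fun h0 => ?_
    have h0' : ν ((f : Winf) * f) = 0 := by rw [hν _ (hsq _), ← h0]
    have hn : 0 < ‖(f : Winf)‖ := by simpa using hf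
    -- scale
    set r : ℝ := (K ^ 2 * N 1 + 1) / ‖(f : Winf)‖ with hr
    have := hbasic (r • (f : Winf)) (V.smul_mem _ f.2)
    have hN := h.nonneg 1
    have hr0 : 0 ≤ r := by positivity
    rw [winf_smul_mul, winf_mul_smul, map_smul, map_smul, h0', norm_smul, Real.norm_eq_abs, abs_of_nonneg hr0, hr,
      div_mul_cancel₀ _ hn.ne'] at this
    have : 0 ≤ K ^ 2 * N 1 := by positivity
    simp at *
    linarith
  have hex := @LinearMap.BilinForm.exists_orthogonal_basis V ℝ _ _ _ _
    (invertibleOfNonzero two_ne_zero) B hsymm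
  set d := Module.finrank ℝ V with hd
  obtain ⟨v, hv⟩ := hex
  set s : Fin d → ℝ := fun i => B (v i) (v i) with hs
  have hs0 : ∀ i, 0 < s i := fun i => hpos _ (v.ne_zero i)
  have hvo : ∀ i j, i ≠ j → B (v i) (v j) = 0 := fun i j hij => hv hij
  have hpt : ∀ n, ∑ i, ((v i : Winf) n) ^ 2 / s i ≤ K ^ 2 * N 1 := by
    intro n
    set t := ∑ i, ((v i : Winf) n) ^ 2 / s i with ht
    set w : V := ∑ i, ((v i : Winf) n / s i) • v i with hw
    have hwn : (w : Winf) n = t := by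
      rw [hw, ht]
      simp only [Submodule.coe_sum, Submodule.coe_smul, BoundedContinuousFunction.coe_sum,
        Finset.sum_apply, BoundedContinuousFunction.coe_smul, smul_eq_mul]
      refine Finset.sum_congr rfl fun i _ => ?_
      ring
    have hww : ν ((w : Winf) * w) = t := by
      rw [← hB, hw, ht]
      simp only [map_sum, LinearMap.sum_apply, map_smul, LinearMap.smul_apply, smul_eq_mul]
      refine Finset.sum_congr rfl fun i _ => ?_
      rw [Finset.sum_eq_single i]
      · change _ * (_ * s i) = _
        have := (hs0 i).ne'
        field_simp
      · intro j _ hj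
        rw [hvo j i hj]; ring
      · simp
    have h1 := hbasic w w.2
    rw [hww] at h1
    have h2 := winf_abs_le w n
    rw [hwn] at h2
    have h3 := le_abs_self t
    linarith
  have hfin : ν (∑ i, (1 / s i) • ((v i : Winf) * (v i : Winf))) = d := by
    rw [map_sum]
    have : ∀ i, ν ((1 / s i) • ((v i : Winf) * (v i : Winf))) = 1 := by
      intro i
      rw [map_smul, ← hB, smul_eq_mul]
      exact one_div_mul_cancel (hs0 i).ne'
    rw [Finset.sum_congr rfl fun i _ => this i]
    simp
  have hval : ∀ n, (∑ i, (1 / s i) • ((v i : Winf) * (v i : Winf))) n =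
      ∑ i, ((v i : Winf) n) ^ 2 / s i := by
    intro n
    simp only [BoundedContinuousFunction.coe_sum,
        Finset.sum_apply, BoundedContinuousFunction.coe_smul, smul_eq_mul,
        BoundedContinuousFunction.coe_mul, Pi.mul_apply]
    refine Finset.sum_congr rfl fun i _ => ?_
    ring
  have hnn : ∀ n, 0 ≤ ∑ i, ((v i : Winf) n) ^ 2 / s i := fun n =>
    Finset.sum_nonneg fun i _ => div_nonneg (sq_nonneg _) (hs0 i).le
  rw [← hfin, hν _ (fun n => by rw [hval]; exact hnn n)]
  have hN := h.nonneg 1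
  rw [← h.smul _ _ (by positivity)]
  apply h.mono
  intro n
  rw [hval, abs_of_nonneg (hnn n)]
  refine (hpt n).trans ((le_of_eq ?_).trans (le_abs_self _))
  simp

theorem rosenthal_aux (lam : ℕ → Set ℕ → ℝ) (h0 : ∀ n A, 0 ≤ lam n A)
    (hsup : ∀ n A B C, Disjoint A B → A ⊆ C → B ⊆ C → lam n A + lam n B ≤ lam n C)
    (ε : ℝ) (hε : 0 < ε) : ∀ (k : ℕ) (e : ℕ → ℕ), Function.Injective e →
      (∀ n, lam (e n) (Set.range e) ≤ k * ε) →
      ∃ e' : ℕ → ℕ, Function.Injective e' ∧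
        ∀ n, lam (e' n) (Set.range e' \ {e' n}) ≤ ε := by
  intro k
  induction k with
  | zero =>
    intro e he h
    refine ⟨e, he, fun n => ?_⟩
    have h1 := hsup (e n) (Set.range e \ {e n}) ∅ (Set.range e) (by simp) Set.sdiff_subset (by simp)
    have h2 := h0 (e n) ∅
    have h3 := h n
    simp at h3
    linarith
  | succ k ih =>
    intro e he h
    by_cases H : ∃ p, ∀ q, lam (e (Nat.pair p q))
        (Set.range (fun q => e (Nat.pair p q)) \ {e (Nat.pair p q)}) ≤ ε
    · obtain ⟨p, hp⟩ := H
      refine ⟨fun q => e (Nat.pair p q), fun a b hab => ?_, hp⟩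
      have := he hab
      rw [Nat.pair_eq_pair] at this
      exact this.2
    · push Not at H
      choose q hq using H
      refine ih (fun p => e (Nat.pair p (q p))) (fun a b hab => ?_) (fun p => ?_)
      · have := he hab
        rw [Nat.pair_eq_pair] at this
        exact this.1
      · have h1 := hsup (e (Nat.pair p (q p))) (Set.range (fun p => e (Nat.pair p (q p))))
          (Set.range (fun r => e (Nat.pair p r)) \ {e (Nat.pair p (q p))}) (Set.range e) (by
            rw [Set.disjoint_left]
            rintro _ ⟨a, rfl⟩ ⟨⟨b, hb⟩, hne⟩
            have := he hb
            rw [Nat.pair_eq_pair] at this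
            obtain ⟨rfl, -⟩ := this
            exact hne rfl) (by rintro _ ⟨a, rfl⟩; exact ⟨_, rfl⟩)
          (by rintro _ ⟨⟨a, rfl⟩, -⟩; exact ⟨_, rfl⟩)
        have h2 := hq p
        have h3 := h (Nat.pair p (q p))
        push_cast at h3
        linarith

open Classical in
/-- Indicator function of a set, as an element of `ℓ∞`. -/
def chiW (A : Set ℕ) : Winf :=
  BoundedContinuousFunction.ofNormedAddCommGroupDiscrete (fun n => if n ∈ A then (1 : ℝ) else 0) 1
    (fun n => by split_ifs <;> simp)

open Classical in
theorem chiW_apply (A : Set ℕ) (n : ℕ) : chiW A n = if n ∈ A then (1 : ℝ) else 0 := rfl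

theorem chiW_mem {A : Set ℕ} {n : ℕ} (h : n ∈ A) : chiW A n = 1 := by simp [chiW_apply, h]

theorem chiW_not_mem {A : Set ℕ} {n : ℕ} (h : n ∉ A) : chiW A n = 0 := by simp [chiW_apply, h]

theorem chiW_nonneg (A : Set ℕ) (n : ℕ) : 0 ≤ chiW A n := by
  rw [chiW_apply]; split_ifs <;> simp

theorem chiW_le_one (A : Set ℕ) (n : ℕ) : chiW A n ≤ 1 := by
  rw [chiW_apply]; split_ifs <;> simp

theorem chiW_norm_le (A : Set ℕ) : ‖chiW A‖ ≤ 1 := by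
  rw [winf_norm_le_iff zero_le_one]
  intro n
  rw [abs_of_nonneg (chiW_nonneg A n)]
  exact chiW_le_one A n

theorem chiW_mono {A B : Set ℕ} (h : A ⊆ B) (n : ℕ) : chiW A n ≤ chiW B n := by
  by_cases hn : n ∈ A
  · rw [chiW_mem hn, chiW_mem (h hn)]
  · rw [chiW_not_mem hn]; exact chiW_nonneg _ _

theorem PosF.chi_mono {N : Winf → ℝ} (h : PosF N) {A B : Set ℕ} (hAB : A ⊆ B) :
    N (chiW A) ≤ N (chiW B) :=
  h.mono _ _ fun n => by
    rw [abs_of_nonneg (chiW_nonneg _ _), abs_of_nonneg (chiW_nonneg _ _)]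
    exact chiW_mono hAB n

theorem PosF.chi_super {N : Winf → ℝ} (h : PosF N) {A B C : Set ℕ} (hAB : Disjoint A B)
    (hA : A ⊆ C) (hB : B ⊆ C) : N (chiW A) + N (chiW B) ≤ N (chiW C) := by
  rw [← h.add _ _ (chiW_nonneg A) (chiW_nonneg B)]
  refine h.mono _ _ fun n => ?_
  have hA0 := chiW_nonneg A n
  have hB0 := chiW_nonneg B n
  simp only [BoundedContinuousFunction.coe_add, Pi.add_apply]
  rw [abs_of_nonneg (by positivity), abs_of_nonneg (chiW_nonneg _ _)]
  by_cases hn : n ∈ A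
  · have : n ∉ B := fun h' => Set.disjoint_left.1 hAB hn h'
    rw [chiW_not_mem this, add_zero]
    exact chiW_mono hA n
  · rw [chiW_not_mem hn, zero_add]
    exact chiW_mono hB n

theorem PosF.chi_union {N : Winf → ℝ} (h : PosF N) (A B : Set ℕ) :
    N (chiW (A ∪ B)) ≤ N (chiW A) + N (chiW B) := by
  rw [← h.add _ _ (chiW_nonneg A) (chiW_nonneg B)]
  refine h.mono _ _ fun n => ?_
  have hA0 := chiW_nonneg A n
  have hB0 := chiW_nonneg B n
  simp only [BoundedContinuousFunction.coe_add, Pi.add_apply]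
  rw [abs_of_nonneg (chiW_nonneg _ _), abs_of_nonneg (by positivity)]
  by_cases hn : n ∈ A ∪ B
  · rw [chiW_mem hn]
    rcases hn with hn | hn
    · rw [chiW_mem hn]; linarith
    · rw [chiW_mem hn]; linarith
  · rw [chiW_not_mem hn]; linarith

theorem coordN (R : Winf →L[ℝ] Winf) : ∃ N : ℕ → Winf → ℝ, ∀ i, PosF (N i) ∧
    (∀ f, |R f i| ≤ N i f) ∧ ∀ f, N i f ≤ ‖R‖ * ‖f‖ := by
  have : ∀ i, ∃ N : Winf → ℝ, PosF N ∧ (∀ f, |R f i| ≤ N f) ∧ ∀ f, N f ≤ ‖R‖ * ‖f‖ := by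
    intro i
    let φ : Winf →L[ℝ] ℝ := (BoundedContinuousFunction.evalCLM ℝ i).comp R
    have hφ : ∀ f, φ f = R f i := fun f => rfl
    obtain ⟨N, h1, h2, h3⟩ := dominate φ
    refine ⟨N, h1, fun f => hφ f ▸ h2 f, fun f => (h3 f).trans ?_⟩
    gcongr
    refine ContinuousLinearMap.opNorm_le_bound _ R.opNorm_nonneg fun f => ?_
    rw [hφ]
    exact (winf_abs_le _ _).trans (R.le_opNorm f)
  choose N hN using this
  exact ⟨N, hN⟩

/-- The submeasure associated with an operator on `ℓ∞`. -/
def mR (R : Winf →L[ℝ] Winf) (A : Set ℕ) : ℝ :=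
  ‖R.comp (ContinuousLinearMap.mul ℝ Winf (chiW A))‖

theorem mR_apply_le (R : Winf →L[ℝ] Winf) (A : Set ℕ) (f : Winf) :
    ‖R (chiW A * f)‖ ≤ mR R A * ‖f‖ :=
  (R.comp (ContinuousLinearMap.mul ℝ Winf (chiW A))).le_opNorm f

theorem mR_nonneg (R : Winf →L[ℝ] Winf) (A : Set ℕ) : 0 ≤ mR R A :=
  ContinuousLinearMap.opNorm_nonneg _

theorem mR_le (R : Winf →L[ℝ] Winf) (A : Set ℕ) (C : ℝ) (hC : 0 ≤ C)
    (h : ∀ f, ‖R (chiW A * f)‖ ≤ C * ‖f‖) : mR R A ≤ C :=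
  ContinuousLinearMap.opNorm_le_bound _ hC h

theorem mR_exists (R : Winf →L[ℝ] Winf) (A : Set ℕ) (δ : ℝ) (h : δ < mR R A) (hδ : 0 ≤ δ) :
    ∃ f : Winf, ‖f‖ ≤ 1 ∧ ∃ i, δ < |R (chiW A * f) i| := by
  obtain ⟨f, hf, h2⟩ := ContinuousLinearMap.exists_lt_apply_of_lt_opNorm _ h
  refine ⟨f, hf.le, ?_⟩
  by_contra! hcon
  have : ‖R (chiW A * f)‖ ≤ δ := (winf_norm_le_iff hδ).2 hcon
  exact absurd h2 (not_lt.2 this)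

theorem chiW_mul_norm_le (A : Set ℕ) (f : Winf) : ‖chiW A * f‖ ≤ ‖f‖ := by
  rw [winf_norm_le_iff (norm_nonneg _)]
  intro n
  simp only [BoundedContinuousFunction.coe_mul, Pi.mul_apply, abs_mul]
  rw [abs_of_nonneg (chiW_nonneg A n)]
  calc _ ≤ 1 * |f n| := by gcongr; exact chiW_le_one A n
    _ ≤ ‖f‖ := by rw [one_mul]; exact winf_abs_le f n

theorem mR_mono (R : Winf →L[ℝ] Winf) {A B : Set ℕ} (h : A ⊆ B) : mR R A ≤ mR R B := by
  refine mR_le R A _ (mR_nonneg _ _) fun f => ?_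
  have : chiW A * f = chiW B * (chiW A * f) := by
    ext n
    simp only [BoundedContinuousFunction.coe_mul, Pi.mul_apply]
    by_cases hn : n ∈ A
    · rw [chiW_mem hn, chiW_mem (h hn)]; ring
    · rw [chiW_not_mem hn]; ring
  rw [this]
  refine (mR_apply_le R B _).trans ?_
  gcongr
  · exact mR_nonneg _ _
  · exact chiW_mul_norm_le A f

theorem mR_union (R : Winf →L[ℝ] Winf) (A B : Set ℕ) : mR R (A ∪ B) ≤ mR R A + mR R B := by
  refine mR_le R _ _ (add_nonneg (mR_nonneg _ _) (mR_nonneg _ _)) fun f => ?_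
  have : chiW (A ∪ B) * f = chiW A * f + chiW B * (chiW Aᶜ * f) := by
    ext n
    simp only [BoundedContinuousFunction.coe_mul, Pi.mul_apply, BoundedContinuousFunction.coe_add,
      Pi.add_apply]
    by_cases hn : n ∈ A
    · rw [chiW_mem hn, chiW_mem (Or.inl hn), chiW_not_mem (A := Aᶜ) (by simpa using hn)]; ring
    · rw [chiW_not_mem hn, chiW_mem (A := Aᶜ) hn]
      by_cases hb : n ∈ B
      · rw [chiW_mem hb, chiW_mem (Or.inr hb)]; ring
      · rw [chiW_not_mem hb, chiW_not_mem (by simp [hn, hb])]; ring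
  rw [this, map_add, add_mul]
  refine (norm_add_le _ _).trans (add_le_add (mR_apply_le _ _ _) ((mR_apply_le _ _ _).trans ?_))
  gcongr
  · exact mR_nonneg _ _
  · exact chiW_mul_norm_le _ f

theorem exhaustive (R : Winf →L[ℝ] Winf) (hR : TopologicalSpace.IsSeparable (Set.range R))
    (D : ℕ → Set ℕ) (hD : ∀ i j, i ≠ j → Disjoint (D i) (D j)) (δ : ℝ) (hδ : 0 < δ)
    (hm : ∀ k, δ < mR R (D k)) : False := by
  classical
  have hm' := fun k => mR_exists R (D k) δ (hm k) hδ.le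
  choose f hf i hi using hm'
  obtain ⟨N0, hN0⟩ := coordN R
  set N := fun k => N0 (i k) with hN
  have hDu : ∀ {k l n}, n ∈ D k → n ∈ D l → k = l := by
    intro k l n hk hl
    by_contra hne
    exact Set.disjoint_left.1 (hD k l hne) hk hl
  -- the glued function
  let F0 : ℕ → ℝ := fun n => if h : ∃ k, n ∈ D k then f h.choose n else 0
  have hF0 : ∀ n, ‖F0 n‖ ≤ 1 := by
    intro n
    simp only [F0]
    split_ifs with h
    · exact (winf_abs_le _ _).trans (hf _)
    · simp
  let F : Winf := BoundedContinuousFunction.ofNormedAddCommGroupDiscrete F0 1 hF0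
  have hF1 : ∀ n, |F n| ≤ 1 := hF0
  have hF : ∀ k n, n ∈ D k → F n = f k n := by
    intro k n hn
    have h : ∃ k, n ∈ D k := ⟨k, hn⟩
    have : h.choose = k := hDu h.choose_spec hn
    change F0 n = _
    simp only [F0]
    rw [dif_pos h, this]
  let U : Set ℕ → Set ℕ := fun A => ⋃ j ∈ A, D j
  have hU : ∀ A n, n ∈ U A ↔ ∃ j ∈ A, n ∈ D j := fun A n => by simp [U]
  have hUm : ∀ A B, A ⊆ B → U A ⊆ U B := by
    intro A B h n hn
    rw [hU] at hn ⊢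
    obtain ⟨j, hj, hn⟩ := hn
    exact ⟨j, h hj, hn⟩
  obtain ⟨K, hK⟩ := exists_nat_ge (‖R‖ / (δ / 4))
  obtain ⟨e, he, hsmall⟩ := rosenthal_aux (fun k A => N k (chiW (U A)))
    (fun k A => (hN0 (i k)).1.nonneg _)
    (fun k A B C hAB hA hB => (hN0 (i k)).1.chi_super (by
      rw [Set.disjoint_left]
      intro n hn hn'
      rw [hU] at hn hn'
      obtain ⟨j, hj, hn⟩ := hn
      obtain ⟨j', hj', hn'⟩ := hn'
      obtain rfl := hDu hn hn'
      exact Set.disjoint_left.1 hAB hj hj') (hUm _ _ hA) (hUm _ _ hB))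
    (δ / 4) (by positivity) K id Function.injective_id (fun n => by
      refine ((hN0 (i n)).2.2 _).trans ?_
      rw [div_le_iff₀ (by positivity)] at hK
      refine le_trans ?_ hK
      exact mul_le_of_le_one_right R.opNorm_nonneg (chiW_norm_le _))
  let G : Set ℕ → Winf := fun S => chiW (U (e '' S)) * F
  have hG : ∀ S n, G S n = chiW (U (e '' S)) n * F n := fun S n => rfl
  have hsep0 : ∀ S S' : Set ℕ, ∀ n ∈ S, n ∉ S' → 3 * δ / 4 ≤ ‖R (G S) - R (G S')‖ := by
    intro S S' n hn hn'
    set k := e n with hk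
    set rest : Winf := G S - G S' - chiW (D k) * f k with hrest
    have hr : N k rest ≤ δ / 4 := by
      refine le_trans ((hN0 (i k)).1.mono _ _ fun x => ?_) (hsmall n)
      rw [abs_of_nonneg (chiW_nonneg _ _)]
      have hx : rest x = chiW (U (e '' S)) x * F x - chiW (U (e '' S')) x * F x
        - chiW (D k) x * f k x := rfl
      rw [hx]
      by_cases hxk : x ∈ D k
      · rw [chiW_mem (A := U (e '' S)), chiW_not_mem (A := U (e '' S')), chiW_mem hxk, hF k x hxk]
        · simpa using chiW_nonneg _ _
        · rw [hU]
          rintro ⟨j, ⟨a, ha, rfl⟩, hj⟩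
          have := he (hDu hxk hj)
          exact hn' (this ▸ ha)
        · rw [hU]
          exact ⟨k, ⟨n, hn, rfl⟩, hxk⟩
      · rw [chiW_not_mem hxk]
        by_cases hxU : x ∈ U (Set.range e \ {e n})
        · rw [chiW_mem hxU]
          have h1 := hF1 x
          have e1 : chiW (U (e '' S)) x * F x - chiW (U (e '' S')) x * F x - 0 * f k x =
            (chiW (U (e '' S)) x - chiW (U (e '' S')) x) * F x := by ring
          rw [e1, abs_mul]
          have h2 : |chiW (U (e '' S)) x - chiW (U (e '' S')) x| ≤ 1 := by
            rw [abs_le]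
            have a1 := chiW_nonneg (U (e '' S)) x
            have a2 := chiW_nonneg (U (e '' S')) x
            have a3 := chiW_le_one (U (e '' S)) x
            have a4 := chiW_le_one (U (e '' S')) x
            constructor <;> linarith
          exact mul_le_one₀ h2 (abs_nonneg _) h1
        · have hno : ∀ T : Set ℕ, x ∉ U (e '' T) := by
            intro T hT
            apply hxU
            rw [hU] at hT ⊢
            obtain ⟨j, ⟨a, ha, rfl⟩, hj⟩ := hT
            refine ⟨e a, ⟨⟨a, rfl⟩, ?_⟩, hj⟩
            rintro h
            have h : e a = e n := h
            rw [h] at hj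
            exact hxk hj
          rw [chiW_not_mem (hno S), chiW_not_mem (hno S')]
          simpa using chiW_nonneg _ _
    have h1 : R (G S) - R (G S') = R (chiW (D k) * f k) + R rest := by
      rw [← map_sub, ← map_add, hrest]
      congr 1
      abel
    have h2 := winf_abs_le (R (G S) - R (G S')) (i k)
    rw [h1] at h2 ⊢
    have h3 := hi k
    have h4 : |R rest (i k)| ≤ δ / 4 := ((hN0 (i k)).2.1 rest).trans hr
    have h5 : |R (chiW (D k) * f k) (i k)| ≤
        |(R (chiW (D k) * f k) + R rest) (i k)| + |R rest (i k)| := by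
      have : R (chiW (D k) * f k) (i k) =
        (R (chiW (D k) * f k) + R rest) (i k) - R rest (i k) := by simp
      rw [this]
      exact abs_sub _ _
    linarith
  have hsep : ∀ S S' : Set ℕ, S ≠ S' → 3 * δ / 4 ≤ ‖R (G S) - R (G S')‖ := by
    intro S S' hne
    by_cases h : ∃ n ∈ S, n ∉ S'
    · obtain ⟨n, h1, h2⟩ := h
      exact hsep0 S S' n h1 h2
    · push Not at h
      have : ∃ n ∈ S', n ∉ S := by
        by_contra! h'
        exact hne (Set.Subset.antisymm h h')
      obtain ⟨n, h1, h2⟩ := this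
      rw [norm_sub_rev]
      exact hsep0 S' S n h1 h2
  obtain ⟨c, hc, hcl⟩ := hR
  have hch : ∀ S : Set ℕ, ∃ d ∈ c, dist (R (G S)) d < δ / 4 := fun S =>
    Metric.mem_closure_iff.1 (hcl ⟨G S, rfl⟩) (δ / 4) (by positivity)
  choose d hdc hd using hch
  obtain ⟨q, hq⟩ := Set.countable_iff_exists_injOn.1 hc
  refine Function.cantor_injective (fun S => q (d S)) fun S S' hSS => ?_
  by_contra hne
  have h1 := hq (hdc S) (hdc S') hSS
  have h2 := hd S
  have h3 := hd S'
  rw [← h1] at h3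
  have h4 := hsep S S' hne
  rw [← dist_eq_norm] at h4
  have h5 := dist_triangle_right (R (G S)) (R (G S')) (d S)
  linarith

theorem exh_mono (R : Winf →L[ℝ] Winf) (hR : TopologicalSpace.IsSeparable (Set.range R))
    (B : ℕ → Set ℕ) (hB : Monotone B) (ε : ℝ) (hε : 0 < ε) :
    ∃ T, ∀ n, T ≤ n → mR R (B n \ B T) ≤ ε := by
  by_contra! H
  choose g hg hg' using H
  let a : ℕ → ℕ := fun k => Nat.rec 0 (fun _ x => g x) k
  have ha : ∀ k, a (k + 1) = g (a k) := fun k => rfl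
  have ham : Monotone a := monotone_nat_of_le_succ fun k => by rw [ha]; exact hg _
  have hdis : ∀ i j, i < j → Disjoint (B (a (i + 1)) \ B (a i)) (B (a (j + 1)) \ B (a j)) := by
    intro i j hij
    rw [Set.disjoint_left]
    rintro x ⟨hx, -⟩ ⟨-, hx'⟩
    exact hx' (hB (ham hij) hx)
  refine exhaustive R hR (fun k => B (a (k + 1)) \ B (a k)) (fun i j hij => ?_) ε hε
    (fun k => hg' (a k))
  rcases lt_or_gt_of_ne hij with h | h
  · exact hdis i j h
  · exact (hdis j i h).symm

theorem abscont (R : Winf →L[ℝ] Winf) (hR : TopologicalSpace.IsSeparable (Set.range R))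
    (N : ℕ → Winf → ℝ) (hN : ∀ i, PosF (N i)) (hdom : ∀ i f, |R f i| ≤ N i f)
    (A : ℕ → Set ℕ) (C : ℕ → ℝ) (hA : ∀ i j, N i (chiW (A j)) ≤ C i * (1 / 2) ^ j)
    (ε : ℝ) (hε : 0 < ε) (hm : ∀ j, 4 * ε ≤ mR R (A j)) : False := by
  have hC : ∀ i, 0 ≤ C i := fun i => by
    have h1 := hA i 0
    have h2 := (hN i).nonneg (chiW (A 0))
    simp at h1
    linarith
  let U : ℕ → ℕ → Set ℕ := fun k n => {x | ∃ j, k ≤ j ∧ j ≤ n ∧ x ∈ A j}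
  have hUm : ∀ k, Monotone (U k) := by
    rintro k m n hmn x ⟨j, h1, h2, h3⟩
    exact ⟨j, h1, h2.trans hmn, h3⟩
  have hUN0 : ∀ i k t, N i (chiW (U k (k + t))) ≤
      C i * (2 * (1 / 2) ^ k - (1 / 2) ^ (k + t)) := by
    intro i k t
    induction t with
    | zero =>
      have : U k (k + 0) ⊆ A k := by
        rintro x ⟨j, h1, h2, h3⟩
        have : j = k := by omega
        exact this ▸ h3
      refine ((hN i).chi_mono this).trans ((hA i k).trans (le_of_eq ?_))
      simp only [add_zero]
      ring
    | succ t ih =>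
      have : U k (k + (t + 1)) ⊆ U k (k + t) ∪ A (k + (t + 1)) := by
        rintro x ⟨j, h1, h2, h3⟩
        rcases Nat.lt_or_ge j (k + (t + 1)) with h | h
        · exact Or.inl ⟨j, h1, by omega, h3⟩
        · have : j = k + (t + 1) := by omega
          exact Or.inr (this ▸ h3)
      refine ((hN i).chi_mono this).trans (((hN i).chi_union _ _).trans
        ((add_le_add ih (hA i _)).trans (le_of_eq ?_)))
      rw [← add_assoc, pow_succ]
      ring
  have hUN : ∀ i k n, N i (chiW (U k n)) ≤ C i * (2 * (1 / 2) ^ k) := by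
    intro i k n
    refine ((hN i).chi_mono (hUm k (Nat.le_add_left n k))).trans ((hUN0 i k n).trans ?_)
    refine mul_le_mul_of_nonneg_left ?_ (hC i)
    have : (0 : ℝ) ≤ (1 / 2) ^ (k + n) := by positivity
    linarith
  have hT : ∀ k, ∃ T, ∀ n, T ≤ n → mR R (U k n \ U k T) ≤ ε * (1 / 2) ^ (k + 1) := fun k =>
    exh_mono R hR (U k) (hUm k) _ (by positivity)
  choose T hT using hT
  have hAC : ∀ j k, k ≤ j → mR R (A j \ U k (T k)) ≤ ε * (1 / 2) ^ (k + 1) := by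
    intro j k hkj
    refine (mR_mono R ?_).trans (hT k (max j (T k)) (le_max_right _ _))
    rintro x ⟨h1, h2⟩
    exact ⟨⟨j, hkj, le_max_left _ _, h1⟩, h2⟩
  let D : ℕ → Set ℕ := fun n => {x | ∀ k ≤ n, x ∈ U k (T k)}
  have hDanti : ∀ m n, m ≤ n → D n ⊆ D m := fun m n hmn x hx k hk => hx k (hk.trans hmn)
  have hAD : ∀ n j, n ≤ j → mR R (A j \ D n) ≤ ε * (1 - (1 / 2) ^ (n + 1)) := by
    intro n
    induction n with
    | zero =>
      intro j hj
      refine (mR_mono R ?_).trans ((hAC j 0 hj).trans (le_of_eq (by norm_num)))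
      rintro x ⟨h1, h2⟩
      refine ⟨h1, fun h3 => h2 fun k hk => ?_⟩
      obtain rfl : k = 0 := by omega
      exact h3
    | succ n ih =>
      intro j hj
      have : A j \ D (n + 1) ⊆ (A j \ D n) ∪ (A j \ U (n + 1) (T (n + 1))) := by
        rintro x ⟨h1, h2⟩
        by_contra hcon
        apply h2
        have hx1 : x ∈ D n := by
          by_contra h; exact hcon (Or.inl ⟨h1, h⟩)
        have hx2 : x ∈ U (n + 1) (T (n + 1)) := by
          by_contra h; exact hcon (Or.inr ⟨h1, h⟩)
        intro k hk
        rcases Nat.lt_or_ge k (n + 1) with h | h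
        · exact hx1 k (by omega)
        · obtain rfl : k = n + 1 := by omega
          exact hx2
      refine (mR_mono R this).trans ((mR_union R _ _).trans
        ((add_le_add (ih j (by omega)) (hAC j (n + 1) hj)).trans (le_of_eq ?_)))
      rw [pow_succ (1 / 2 : ℝ) (n + 1)]
      ring
  obtain ⟨n0, hn0⟩ := exh_mono R hR (fun n => (D n)ᶜ)
    (fun m n hmn => Set.compl_subset_compl.2 (hDanti m n hmn)) ε hε
  have hDbig : 2 * ε < mR R (D n0) := by
    have h1 : A n0 ⊆ (A n0 \ D n0) ∪ D n0 := by
      intro x hx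
      by_cases h : x ∈ D n0
      · exact Or.inr h
      · exact Or.inl ⟨hx, h⟩
    have h2 := (mR_mono R h1).trans (mR_union R _ _)
    have h3 := hAD n0 n0 le_rfl
    have h4 := hm n0
    have h5 : 0 < ε * (1 / 2) ^ (n0 + 1) := by positivity
    linarith
  obtain ⟨f, hf, i, hi⟩ := mR_exists R (D n0) (2 * ε) hDbig (by positivity)
  have hbound : ∀ n, n0 ≤ n → ε ≤ C i * (2 * (1 / 2) ^ n) := by
    intro n hn
    have e1 : chiW (D n0) * f = chiW (D n) * f + chiW ((D n)ᶜ \ (D n0)ᶜ) * f := by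
      ext x
      simp only [BoundedContinuousFunction.coe_mul, Pi.mul_apply, BoundedContinuousFunction.coe_add,
        Pi.add_apply]
      by_cases h1 : x ∈ D n
      · rw [chiW_mem h1, chiW_mem (hDanti _ _ hn h1), chiW_not_mem (A := (D n)ᶜ \ (D n0)ᶜ)
          (fun h => h.1 h1)]
        ring
      · rw [chiW_not_mem h1]
        by_cases h2 : x ∈ D n0
        · rw [chiW_mem h2, chiW_mem (A := (D n)ᶜ \ (D n0)ᶜ) ⟨h1, fun h => h h2⟩]
          ring
        · rw [chiW_not_mem h2, chiW_not_mem (A := (D n)ᶜ \ (D n0)ᶜ) (fun h => h.2 h2)]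
          ring
    rw [e1, map_add] at hi
    have h1 : |R (chiW (D n) * f) i| ≤ C i * (2 * (1 / 2) ^ n) := by
      refine (hdom i _).trans (le_trans ((hN i).mono _ (chiW (U n (T n))) fun x => ?_) (hUN i n (T n)))
      simp only [BoundedContinuousFunction.coe_mul, Pi.mul_apply, abs_mul]
      have hfx : |f x| ≤ 1 := (winf_abs_le f x).trans hf
      refine (mul_le_of_le_one_right (abs_nonneg _) hfx).trans ?_
      rw [abs_of_nonneg (chiW_nonneg _ _), abs_of_nonneg (chiW_nonneg _ _)]
      exact chiW_mono (show D n ⊆ U n (T n) from fun y hy => hy n le_rfl) x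
    have h2 : |R (chiW ((D n)ᶜ \ (D n0)ᶜ) * f) i| ≤ ε := by
      refine (winf_abs_le _ _).trans ((mR_apply_le R _ f).trans ?_)
      exact (mul_le_of_le_one_right (mR_nonneg _ _) hf).trans (hn0 n hn)
    have h3 := abs_add_le (R (chiW (D n) * f) i) (R (chiW ((D n)ᶜ \ (D n0)ᶜ) * f) i)
    simp only [BoundedContinuousFunction.coe_add, Pi.add_apply] at hi
    linarith
  have hlim : Filter.Tendsto (fun n : ℕ => C i * (2 * (1 / 2 : ℝ) ^ n)) Filter.atTop (nhds 0) := by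
    have := (tendsto_pow_atTop_nhds_zero_of_lt_one (r := (1 / 2 : ℝ)) (by norm_num)
      (by norm_num)).const_mul 2 |>.const_mul (C i)
    simpa using this
  have := ge_of_tendsto hlim (Filter.eventually_atTop.2 ⟨n0, hbound⟩)
  linarith

theorem fixed_bound (R : Winf →L[ℝ] Winf) (hR : TopologicalSpace.IsSeparable (Set.range R)) :
    ∃ μ : Winf → ℝ, PosF μ ∧ ∃ K : ℝ, 0 < K ∧ ∀ w, R w = w → ‖w‖ ≤ K * μ w := by
  obtain ⟨N, hN⟩ := coordN R
  have hsum : ∀ f, Summable fun i => (1 / 2 : ℝ) ^ i * N i f := by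
    intro f
    refine Summable.of_nonneg_of_le (fun i => mul_nonneg (by positivity) ((hN i).1.nonneg f))
      (fun i => mul_le_mul_of_nonneg_left ((hN i).2.2 f) (by positivity))
      (summable_geometric_two.mul_right _)
  let μ : Winf → ℝ := fun f => ∑' i, (1 / 2 : ℝ) ^ i * N i f
  have hμ : PosF μ := by
    refine ⟨fun f g hfg => ?_, fun f g hf hg => ?_, fun c f hc => ?_⟩
    · exact (hsum f).tsum_le_tsum (fun i => mul_le_mul_of_nonneg_left ((hN i).1.mono f g hfg)
        (by positivity)) (hsum g)
    · simp only [μ]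
      rw [← (hsum f).tsum_add (hsum g)]
      refine tsum_congr fun i => ?_
      rw [(hN i).1.add f g hf hg]
      ring
    · simp only [μ]
      rw [← tsum_mul_left]
      refine tsum_congr fun i => ?_
      rw [(hN i).1.smul c f hc]
      ring
  have hNμ : ∀ i f, N i f ≤ 2 ^ i * μ f := by
    intro i f
    have h1 := (hsum f).le_tsum i (fun j _ => mul_nonneg (by positivity) ((hN j).1.nonneg f))
    have h2 : N i f = 2 ^ i * ((1 / 2 : ℝ) ^ i * N i f) := by
      rw [← mul_assoc, ← mul_pow]; norm_num
    rw [h2]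
    exact mul_le_mul_of_nonneg_left h1 (by positivity)
  have hδ : ∃ j : ℕ, ∀ A, μ (chiW A) ≤ (1 / 2) ^ j → mR R A < 4 * (1 / 16) := by
    by_contra! H
    choose A hA hA' using H
    refine abscont R hR N (fun i => (hN i).1) (fun i f => (hN i).2.1 f) A (fun i => 2 ^ i)
      (fun i j => ?_) (1 / 16) (by norm_num) hA'
    exact (hNμ i _).trans (mul_le_mul_of_nonneg_left (hA j) (by positivity))
  obtain ⟨j, hj⟩ := hδ
  set δ : ℝ := (1 / 2) ^ j with hδ
  have hδ0 : 0 < δ := by positivity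
  have hR0 : 0 ≤ ‖R‖ := R.opNorm_nonneg
  set η : ℝ := 1 / (4 * (‖R‖ + 1)) with hη
  have hη0 : 0 < η := by positivity
  have hη1 : ‖R‖ * η ≤ 1 / 4 := by
    rw [hη, mul_one_div, div_le_div_iff₀ (by positivity) (by norm_num)]
    linarith
  have hunit : ∀ w, R w = w → ‖w‖ = 1 → η * δ ≤ μ w := by
    intro w hw hw1
    by_contra! hlt
    let A : Set ℕ := {n | η < |w n|}
    have h1 : μ (chiW A) ≤ δ := by
      have h2 : μ (η • chiW A) ≤ μ w := by
        refine hμ.mono _ _ fun n => ?_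
        simp only [BoundedContinuousFunction.coe_smul, smul_eq_mul]
        by_cases hn : n ∈ A
        · rw [chiW_mem hn, mul_one, abs_of_pos hη0]
          exact le_of_lt hn
        · rw [chiW_not_mem hn]; simp
      rw [hμ.smul _ _ hη0.le] at h2
      have := h2.trans hlt.le
      exact le_of_mul_le_mul_left this hη0
    have h2 := hj A h1
    have e1 : w = chiW A * w + chiW Aᶜ * w := by
      ext n
      simp only [BoundedContinuousFunction.coe_mul, Pi.mul_apply, BoundedContinuousFunction.coe_add,
        Pi.add_apply]
      by_cases hn : n ∈ A
      · rw [chiW_mem hn, chiW_not_mem (A := Aᶜ) (fun h => h hn)]; ring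
      · rw [chiW_not_mem hn, chiW_mem (A := Aᶜ) hn]; ring
    have h3 : ‖chiW Aᶜ * w‖ ≤ η := by
      rw [winf_norm_le_iff hη0.le]
      intro n
      simp only [BoundedContinuousFunction.coe_mul, Pi.mul_apply]
      by_cases hn : n ∈ A
      · rw [chiW_not_mem (A := Aᶜ) (fun h => h hn)]; simpa using hη0.le
      · rw [chiW_mem (A := Aᶜ) hn, one_mul]; exact not_lt.1 hn
    have h4 : ‖w‖ ≤ ‖R (chiW A * w)‖ + ‖R (chiW Aᶜ * w)‖ := by
      calc ‖w‖ = ‖R w‖ := by rw [hw]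
        _ = ‖R (chiW A * w) + R (chiW Aᶜ * w)‖ := by rw [← map_add, ← e1]
        _ ≤ _ := norm_add_le _ _
    have h5 := mR_apply_le R A w
    have h6 := (R.le_opNorm (chiW Aᶜ * w)).trans (mul_le_mul_of_nonneg_left h3 hR0)
    rw [hw1] at h4 h5
    linarith
  refine ⟨μ, hμ, 1 / (η * δ), by positivity, fun w hw => ?_⟩
  rcases eq_or_ne w 0 with rfl | h0
  · rw [hμ.zero]; simp
  · have hn : 0 < ‖w‖ := norm_pos_iff.2 h0
    have := hunit (‖w‖⁻¹ • w) (by rw [map_smul, hw]) (by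
      rw [norm_smul, norm_inv, norm_norm, inv_mul_cancel₀ hn.ne'])
    rw [hμ.smul _ _ (by positivity), inv_mul_eq_div, le_div_iff₀ hn] at this
    rw [one_div_mul_eq_div, le_div_iff₀ (by positivity)]
    linarith

theorem winf_inj_real : ∃ j : Winf → ℝ, Function.Injective j := by
  have h1 : Cardinal.mk Winf ≤ Cardinal.mk (ℕ → ℝ) :=
    Cardinal.mk_le_of_injective (f := fun w : Winf => (w : ℕ → ℝ)) DFunLike.coe_injective
  have h2 : Cardinal.mk (ℕ → ℝ) = Cardinal.mk ℝ := by
    simp [Cardinal.mk_real]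
  rw [h2, Cardinal.le_def] at h1
  obtain ⟨j⟩ := h1
  exact ⟨j, j.injective⟩

theorem stab_ext {A B : Type*} [NormedAddCommGroup A] [NormedSpace ℝ A] [Nontrivial A]
    [NormedAddCommGroup B] [NormedSpace ℝ B] (ι : A →ₗᵢ[ℝ] B) (hst : PairStable A B)
    (E : Winf →L[ℝ] B) : ∃ S : Winf →L[ℝ] A, ∀ w a, E w = ι a → S w = a := by
  classical
  obtain ⟨j, hj⟩ := winf_inj_real
  obtain ⟨a0, ha0⟩ := exists_ne (0 : A)
  let i : Winf → A := fun w => Real.exp (j w) • a0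
  have hi : Function.Injective i := by
    intro w w' h
    have := smul_left_injective ℝ ha0 h
    exact hj (Real.exp_injective this)
  have hi0 : ∀ w, i w ≠ 0 := fun w => smul_ne_zero (Real.exp_pos _).ne' ha0
  let h : A → Winf := fun a => if ha : ∃ w : Winf, ‖w‖ ≤ 1 ∧ i w = a then ha.choose else 0
  have hh1 : ∀ a, ‖h a‖ ≤ 1 := by
    intro a
    simp only [h]
    split_ifs with ha
    · exact ha.choose_spec.1
    · simp
  have hh0 : h 0 = 0 := by
    simp only [h]
    rw [dif_neg]
    rintro ⟨w, -, hw⟩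
    exact hi0 w hw
  have hhi : ∀ w : Winf, ‖w‖ ≤ 1 → h (i w) = w := by
    intro w hw
    have ha : ∃ w' : Winf, ‖w'‖ ≤ 1 ∧ i w' = i w := ⟨w, hw, rfl⟩
    simp only [h]
    rw [dif_pos ha]
    exact hi ha.choose_spec.2
  have hE0 : 0 ≤ ‖E‖ := E.opNorm_nonneg
  have hEh : ∀ a, ‖E (h a)‖ ≤ ‖E‖ := fun a =>
    (E.le_opNorm _).trans (mul_le_of_le_one_right hE0 (hh1 a))
  let f : A → B := fun a => ι a + E (h a)
  have hf : ∀ a, f a = ι a + E (h a) := fun a => rfl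
  obtain ⟨α, γ, hα, hγ, T, hT, hTf⟩ := hst (2 * ‖E‖ + 1) (by positivity) f ⟨by simp [f, hh0], by
    intro x y
    have e : f x - f y = ι (x - y) + (E (h x) - E (h y)) := by
      rw [hf, hf, map_sub]; abel
    have h1 := abs_norm_sub_norm_le (f x - f y) (ι (x - y))
    rw [e, add_sub_cancel_left, ι.norm_map] at h1
    rw [e]
    have h2 := norm_sub_le (E (h x)) (E (h y))
    have h3 := hEh x
    have h4 := hEh y
    linarith⟩
  have hιmem : ∀ a, ι a ∈ Lf f := by
    intro a
    have hcl : IsClosed (Lf f : Set B) := Submodule.isClosed_topologicalClosure _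
    have hlim : Filter.Tendsto (fun n : ℕ => (1 / ((n : ℝ) + 1)) • f (((n : ℝ) + 1) • a))
        Filter.atTop (nhds (ι a)) := by
      have h0 : Filter.Tendsto (fun n : ℕ => (1 / ((n : ℝ) + 1)) * ‖E‖) Filter.atTop (nhds 0) := by
        simpa using tendsto_one_div_add_atTop_nhds_zero_nat.mul_const ‖E‖
      rw [tendsto_iff_norm_sub_tendsto_zero]
      refine squeeze_zero (fun n => norm_nonneg _) (fun n => ?_) h0
      have hn : ((n : ℝ) + 1) ≠ 0 := by positivity
      rw [hf, smul_add, map_smul, smul_smul, one_div_mul_cancel hn, one_smul, add_sub_cancel_left,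
        norm_smul, Real.norm_eq_abs, abs_of_nonneg (by positivity)]
      exact mul_le_mul_of_nonneg_left (hEh _) (by positivity)
    exact hcl.mem_of_tendsto hlim (Filter.Eventually.of_forall fun n =>
      (Lf f).smul_mem _ (mem_Lf f _))
  have hEmem1 : ∀ w : Winf, ‖w‖ ≤ 1 → E w ∈ Lf f := by
    intro w hw
    have : E w = f (i w) - ι (i w) := by rw [hf, hhi w hw]; abel
    rw [this]
    exact (Lf f).sub_mem (mem_Lf f _) (hιmem _)
  have hEmem : ∀ w : Winf, E w ∈ Lf f := by
    intro w
    rcases eq_or_ne w 0 with rfl | h0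
    · rw [map_zero]; exact (Lf f).zero_mem
    · have hn : ‖w‖ ≠ 0 := norm_ne_zero_iff.2 h0
      have e : E w = ‖w‖ • E (‖w‖⁻¹ • w) := by
        rw [map_smul, smul_smul, mul_inv_cancel₀ hn, one_smul]
      rw [e]
      refine (Lf f).smul_mem _ (hEmem1 _ ?_)
      rw [norm_smul, norm_inv, norm_norm, inv_mul_cancel₀ hn]
  have hT0 : 0 ≤ ‖T‖ := T.opNorm_nonneg
  have hTι : ∀ a, T ⟨ι a, hιmem a⟩ = a := by
    intro a
    have hb : ∀ n : ℕ, (n : ℝ) * ‖T ⟨ι a, hιmem a⟩ - a‖ ≤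
        γ * (2 * ‖E‖ + 1) + ‖T‖ * ‖E‖ := by
      intro n
      have h1 := hTf ((n : ℝ) • a)
      have e : (⟨f ((n : ℝ) • a), mem_Lf f _⟩ : Lf f) =
          (n : ℝ) • (⟨ι a, hιmem a⟩ : Lf f) + ⟨E (h ((n : ℝ) • a)), hEmem _⟩ := by
        apply Subtype.ext
        simp [hf]
      rw [e, map_add, map_smul] at h1
      have h2 := T.le_opNorm ⟨E (h ((n : ℝ) • a)), hEmem _⟩
      have h3 : ‖(⟨E (h ((n : ℝ) • a)), hEmem _⟩ : Lf f)‖ ≤ ‖E‖ := hEh _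
      have h4 := h2.trans (mul_le_mul_of_nonneg_left h3 hT0)
      have e2 : (n : ℝ) • (T ⟨ι a, hιmem a⟩ - a) =
        ((n : ℝ) • T ⟨ι a, hιmem a⟩ + T ⟨E (h ((n : ℝ) • a)), hEmem _⟩ - (n : ℝ) • a) -
          T ⟨E (h ((n : ℝ) • a)), hEmem _⟩ := by
        rw [smul_sub]; abel
      have h5 := norm_sub_le
        ((n : ℝ) • T ⟨ι a, hιmem a⟩ + T ⟨E (h ((n : ℝ) • a)), hEmem _⟩ - (n : ℝ) • a)
        (T ⟨E (h ((n : ℝ) • a)), hEmem _⟩)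
      rw [← e2, norm_smul, Real.norm_natCast] at h5
      linarith
    by_contra hne
    have hp : 0 < ‖T ⟨ι a, hιmem a⟩ - a‖ := norm_pos_iff.2 (sub_ne_zero.2 hne)
    obtain ⟨n, hn⟩ := exists_nat_gt ((γ * (2 * ‖E‖ + 1) + ‖T‖ * ‖E‖) / ‖T ⟨ι a, hιmem a⟩ - a‖)
    rw [div_lt_iff₀ hp] at hn
    exact absurd (hb n) (not_le.2 hn)
  refine ⟨T.comp (E.codRestrict (Lf f) hEmem), fun w a hwa => ?_⟩
  rw [← hTι a]
  change T ⟨E w, _⟩ = _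
  congr 1
  exact Subtype.ext hwa

/-- Separable spaces embed into `ℓ∞`. -/
theorem exists_embed (Z : Type*) [NormedAddCommGroup Z] [NormedSpace ℝ Z]
    [TopologicalSpace.SeparableSpace Z] : ∃ _J : Z →ₗᵢ[ℝ] Winf, True := by
  choose g hg1 hg using fun z : Z => exists_dual_vector'' ℝ z
  let z := TopologicalSpace.denseSeq Z
  have hle : ∀ n x, ‖g (z n) x‖ ≤ ‖x‖ := fun n x => by
    have := (g (z n)).le_of_opNorm_le (hg1 _) x
    simpa using this
  let J : Z →ₗ[ℝ] Winf :=
    { toFun := fun x => BoundedContinuousFunction.ofNormedAddCommGroupDiscrete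
        (fun n => g (z n) x) ‖x‖ (fun n => hle n x)
      map_add' := fun x y => by ext n; simp
      map_smul' := fun c x => by ext n; simp }
  have hJ : ∀ x n, J x n = g (z n) x := fun x n => rfl
  refine ⟨⟨J, fun x => le_antisymm ?_ ?_⟩, trivial⟩
  · rw [winf_norm_le_iff (norm_nonneg _)]
    exact fun n => hle n x
  · refine le_of_forall_pos_le_add fun ε hε => ?_
    obtain ⟨n, hn⟩ := (TopologicalSpace.denseRange_denseSeq Z).exists_dist_lt x (half_pos hε)
    have hn : ‖x - z n‖ < ε / 2 := by rw [← dist_eq_norm]; exact hn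
    have h1 := winf_abs_le (J x) n
    rw [hJ] at h1
    have h2 : g (z n) x = ‖z n‖ + g (z n) (x - z n) := by
      rw [map_sub, hg]; simp
    have h3 := hle n (x - z n)
    rw [Real.norm_eq_abs] at h3
    have h4 := neg_abs_le (g (z n) (x - z n))
    have h5 := le_abs_self (g (z n) x)
    have h6 : ‖x‖ ≤ ‖z n‖ + ‖x - z n‖ := by
      have := norm_add_le (z n) (x - z n)
      simpa using this
    linarith

/-- Every space embeds isometrically in some `ℓ∞(Γ)`, and operators into it extend. -/
theorem exists_embed_ext (X : Type*) [NormedAddCommGroup X] [NormedSpace ℝ X]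
    (Z : Submodule ℝ X) (J : Z →ₗᵢ[ℝ] Winf) :
    ∃ (ι : X →ₗᵢ[ℝ] lp (fun _ : X => ℝ) ∞) (E : Winf →L[ℝ] lp (fun _ : X => ℝ) ∞),
      ∀ z : Z, E (J z) = ι z := by
  choose g hg1 hg using fun z : X => exists_dual_vector'' ℝ z
  have hle : ∀ y x, ‖g y x‖ ≤ ‖x‖ := fun y x => by
    have := (g y).le_of_opNorm_le (hg1 _) x
    simpa using this
  have hext : ∀ y, ∃ G : Winf →L[ℝ] ℝ, ‖G‖ ≤ 1 ∧ ∀ z : Z, G (J z) = g y z := by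
    intro y
    let e := J.equivRange
    let φ : StrongDual ℝ (LinearMap.range J.toLinearMap) :=
      ((g y).comp Z.subtypeL).comp (e.symm : LinearMap.range J.toLinearMap →L[ℝ] Z)
    have hφ : ∀ p, φ p = g y (e.symm p) := fun p => rfl
    obtain ⟨G, hG, hGn⟩ := exists_extension_norm_eq _ φ
    refine ⟨G, ?_, fun z => ?_⟩
    · rw [hGn]
      refine ContinuousLinearMap.opNorm_le_bound _ zero_le_one fun p => ?_
      rw [hφ, one_mul]
      refine (hle y _).trans (le_of_eq ?_)
      exact e.symm.norm_map p
    · have := hG (e z)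
      rw [hφ, e.symm_apply_apply] at this
      exact this
  choose G hG1 hG using hext
  have hGle : ∀ y w, ‖G y w‖ ≤ ‖w‖ := fun y w => by
    have := (G y).le_of_opNorm_le (hG1 _) w
    simpa using this
  let ι0 : X →ₗ[ℝ] lp (fun _ : X => ℝ) ∞ :=
    { toFun := fun x => ⟨fun y => g y x, memℓp_infty ⟨‖x‖, by rintro _ ⟨y, rfl⟩; exact hle y x⟩⟩
      map_add' := fun x x' => by ext y; exact map_add (g y) x x'
      map_smul' := fun c x => by ext y; simp }
  have hι0 : ∀ x y, ι0 x y = g y x := fun x y => rfl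
  let E0 : Winf →ₗ[ℝ] lp (fun _ : X => ℝ) ∞ :=
    { toFun := fun w => ⟨fun y => G y w, memℓp_infty ⟨‖w‖, by rintro _ ⟨y, rfl⟩; exact hGle y w⟩⟩
      map_add' := fun x x' => by ext y; exact map_add (G y) x x'
      map_smul' := fun c x => by ext y; simp }
  have hE0 : ∀ w y, E0 w y = G y w := fun x y => rfl
  refine ⟨⟨ι0, fun x => le_antisymm ?_ ?_⟩, E0.mkContinuous 1 (fun w => ?_), fun z => ?_⟩
  · exact lp.norm_le_of_forall_le (norm_nonneg _) fun y => hle y x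
  · have := lp.norm_apply_le_norm ENNReal.top_ne_zero (ι0 x) x
    rw [hι0, hg] at this
    simpa using this
  · rw [one_mul]
    exact lp.norm_le_of_forall_le (norm_nonneg _) fun y => hGle y w
  · ext y
    exact hG y z

universe u

/-- A Banach space which is both universally left-stable and universally right-stable is
finite dimensional. -/
theorem stmt5 {X : Type u} [NormedAddCommGroup X] [NormedSpace ℝ X] [CompleteSpace X]
    (hleft : ∀ (Y : Type u) [NormedAddCommGroup Y] [NormedSpace ℝ Y] [CompleteSpace Y],
      PairStable X Y)
    (hright : ∀ (Y : Type u) [NormedAddCommGroup Y] [NormedSpace ℝ Y] [CompleteSpace Y],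
      PairStable Y X) :
    FiniteDimensional ℝ X := by
  by_contra hfin
  have hinf : ∃ v : ℕ → X, LinearIndependent ℝ v := by
    have h1 : Cardinal.aleph0 ≤ Module.rank ℝ X := by
      rw [← not_lt, Module.rank_lt_aleph0_iff]
      exact hfin
    obtain ⟨s, hs, hli⟩ := exists_set_linearIndependent ℝ X
    rw [← hs] at h1
    obtain ⟨emb⟩ : Nonempty (ℕ ↪ s) := by
      rw [← Cardinal.lift_mk_le']
      simpa using h1
    exact ⟨_, hli.comp emb emb.injective⟩
  obtain ⟨v, hv⟩ := hinf
  let Z : Submodule ℝ X := (Submodule.span ℝ (Set.range v)).topologicalClosure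
  have hvZ : ∀ n, v n ∈ Z := fun n =>
    Submodule.le_topologicalClosure _ (Submodule.subset_span ⟨n, rfl⟩)
  have hZsep : TopologicalSpace.IsSeparable (Z : Set X) := by
    have h1 : TopologicalSpace.IsSeparable (Submodule.span ℝ (Set.range v) : Set X) :=
      (Set.countable_range v).isSeparable.span
    rw [Submodule.topologicalClosure_coe]
    exact h1.closure
  haveI : TopologicalSpace.SeparableSpace Z := hZsep.separableSpace
  haveI : CompleteSpace Z := (Submodule.isClosed_topologicalClosure _).completeSpace_coe
  haveI : Nontrivial Z := ⟨⟨⟨v 0, hvZ 0⟩, 0, fun h => hv.ne_zero 0 (congrArg Subtype.val h)⟩⟩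
  haveI : Nontrivial X := ⟨⟨v 0, 0, hv.ne_zero 0⟩⟩
  obtain ⟨J, -⟩ := exists_embed Z
  obtain ⟨ι, E, hE⟩ := exists_embed_ext X Z J
  obtain ⟨S, hS⟩ := stab_ext ι (hleft _) E
  obtain ⟨P, hP⟩ := stab_ext Z.subtypeₗᵢ (hright Z) S
  have hPJ : ∀ z : Z, P (J z) = z := fun z => hP _ _ (hS _ _ (hE z))
  let R : Winf →L[ℝ] Winf := J.toContinuousLinearMap.comp P
  have hRJ : ∀ z : Z, R (J z) = J z := fun z => congrArg J (hPJ z)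
  have hRsep : TopologicalSpace.IsSeparable (Set.range R) := by
    refine (TopologicalSpace.isSeparable_range J.continuous).mono ?_
    rintro _ ⟨w, rfl⟩
    exact ⟨P w, rfl⟩
  obtain ⟨μ, hμ, K, hK, hbd⟩ := fixed_bound R hRsep
  obtain ⟨n, hn⟩ := exists_nat_gt (K ^ 2 * μ 1 * μ 1)
  let u : Fin n → Winf := fun k => J ⟨v k, hvZ k⟩
  have hu : LinearIndependent ℝ u := by
    have h1 : LinearIndependent ℝ (fun k : ℕ => (⟨v k, hvZ k⟩ : Z)) :=
      LinearIndependent.of_comp Z.subtype hv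
    have h2 := h1.map' J.toLinearMap (LinearMap.ker_eq_bot.2 J.injective)
    exact h2.comp (fun k : Fin n => (k : ℕ)) Fin.val_injective
  haveI : FiniteDimensional ℝ (Submodule.span ℝ (Set.range u)) :=
    FiniteDimensional.span_of_finite ℝ (Set.finite_range u)
  have hb := finrank_bound hμ K hK (Submodule.span ℝ (Set.range u)) (fun w hw => by
    apply hbd
    have hle : Submodule.span ℝ (Set.range u) ≤ LinearMap.range J.toLinearMap := by
      rw [Submodule.span_le]
      rintro _ ⟨k, rfl⟩
      exact ⟨_, rfl⟩
    obtain ⟨z, rfl⟩ := hle hw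
    exact hRJ z)
  rw [finrank_span_eq_card hu, Fintype.card_fin] at hb
  linarith
end
end

section
/- Let λ ≥ 1 and let X be a λ-injective real Banach space. Then X is universally (λ, 4λ)-left-stable: for every real Banach space Y, every ε > 0, and every standard ε-isometry f : X → Y, there exists a bounded linear operator T : L(f) → X with ‖T‖ ≤ λ such that ‖T(f(x)) − x‖ ≤ 4λε for all x ∈ X. -/
open scoped ENNReal ZeroAtInfty

noncomputable section

universe u

/-- `X` is λ-injective: every bounded linear operator from a closed subspace of a Banach
space into `X` extends to the whole space with norm at most `λ` times the original norm. -/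
def LambdaInjective (lam : ℝ) (X : Type u) [NormedAddCommGroup X] [NormedSpace ℝ X] : Prop :=
  ∀ (Z : Type u) [NormedAddCommGroup Z] [NormedSpace ℝ Z] [CompleteSpace Z],
    ∀ W : Submodule ℝ Z, IsClosed (W : Set Z) →
      ∀ S : W →L[ℝ] X, ∃ S' : Z →L[ℝ] X, (∀ w : W, S' w = S w) ∧ ‖S'‖ ≤ lam * ‖S‖

/-- Lower bound in the finite-dimensional case. -/
theorem lower_fin {F Y : Type*} [NormedAddCommGroup F] [NormedSpace ℝ F] [FiniteDimensional ℝ F]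
    [NormedAddCommGroup Y] [NormedSpace ℝ Y] {ε : ℝ} {f : F → Y} (hf : StdEpsIsom ε f)
    {ι : Type*} (s : Finset ι) (a : ι → ℝ) (v : ι → F) :
    ‖∑ i ∈ s, a i • v i‖ ≤ ‖∑ i ∈ s, a i • f (v i)‖ + 3 * ε * ∑ i ∈ s, |a i| := by
  obtain ⟨hf0, hf⟩ := hf
  have hub : ∀ x y, ‖f x - f y‖ ≤ ‖x - y‖ + ε := fun x y => by
    have := (abs_le.1 (hf x y)).2; linarith
  have hlb : ∀ x y, ‖x - y‖ - ε ≤ ‖f x - f y‖ := fun x y => by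
    have := (abs_le.1 (hf x y)).1; linarith
  -- bound for a point where the norm is differentiable
  have key : ∀ x : F, DifferentiableAt ℝ (fun z : F => ‖z‖) x →
      fderiv ℝ (fun z : F => ‖z‖) x (∑ i ∈ s, a i • v i) ≤
        ‖∑ i ∈ s, a i • f (v i)‖ + 3 * ε * ∑ i ∈ s, |a i| := by
    intro x hx
    set g := fderiv ℝ (fun z : F => ‖z‖) x with hg
    have hlim : ∀ w, Filter.Tendsto (fun c : ℝ => c • (‖x + c⁻¹ • w‖ - ‖x‖)) Filter.atTop
        (nhds (g w)) := fun w => hx.hasFDerivAt.lim_real w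
    have hmin : Filter.Tendsto (fun c : ℝ => ∑ i ∈ s,
        min (a i * (c • (‖x + c⁻¹ • v i‖ - ‖x‖))) (a i * -(c • (‖x + c⁻¹ • (-v i)‖ - ‖x‖))))
        Filter.atTop (nhds (g (∑ i ∈ s, a i • v i))) := by
      rw [map_sum]
      refine tendsto_finsetSum _ fun i _ => ?_
      have h1 := (hlim (v i)).const_mul (a i)
      have h2 := (hlim (-v i)).neg.const_mul (a i)
      have h3 := h1.min h2
      simpa using h3
    refine le_of_tendsto hmin ?_
    filter_upwards [Filter.eventually_gt_atTop (0 : ℝ)] with c hc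
    have hsc : ∀ w, c • (‖x + c⁻¹ • w‖ - ‖x‖) = ‖c • x + w‖ - ‖c • x‖ := by
      intro w
      have : c • x + w = c • (x + c⁻¹ • w) := by
        rw [smul_add, smul_smul, mul_inv_cancel₀ hc.ne', one_smul]
      rw [this, norm_smul, norm_smul, Real.norm_of_nonneg hc.le, smul_eq_mul]; ring
    simp only [hsc]
    obtain ⟨φ, hφ1, hφ⟩ := exists_dual_vector'' ℝ (f (c • x) - f (-(c • x)))
    have hφle : ∀ y, φ y ≤ ‖y‖ := fun y => by
      calc φ y ≤ ‖φ y‖ := le_abs_self _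
        _ ≤ ‖φ‖ * ‖y‖ := φ.le_opNorm y
        _ ≤ 1 * ‖y‖ := by gcongr
        _ = ‖y‖ := one_mul _
    set w := c • x with hw
    have e1 : 2 * ‖w‖ - ε ≤ φ (f w) - φ (f (-w)) := by
      have h := hlb w (-w)
      have h2 : ‖w - -w‖ = 2 * ‖w‖ := by
        rw [sub_neg_eq_add, ← two_smul ℝ, norm_smul]; simp
      rw [h2] at h
      rw [← map_sub, hφ]; exact h
    have e2 : φ (f w) ≤ ‖w‖ + ε := by
      have := hub w 0
      rw [hf0, sub_zero, sub_zero] at this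
      exact (hφle _).trans this
    have e3 : -φ (f (-w)) ≤ ‖w‖ + ε := by
      have := hub 0 (-w)
      rw [hf0, zero_sub, zero_sub, neg_neg] at this
      rw [← map_neg]
      exact (hφle _).trans this
    have up : ∀ y, φ (f y) ≤ ‖w + y‖ - ‖w‖ + 3 * ε := by
      intro y
      have h := (hφle _).trans (hub y (-w))
      rw [map_sub, sub_neg_eq_add, add_comm y w] at h
      linarith
    have lo : ∀ y, -(‖w + -y‖ - ‖w‖) - 3 * ε ≤ φ (f y) := by
      intro y
      have h := (hφle _).trans (hub w y)
      rw [map_sub, sub_eq_add_neg w y] at h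
      linarith
    have hs : φ (∑ i ∈ s, a i • f (v i)) ≤ ‖∑ i ∈ s, a i • f (v i)‖ := hφle _
    refine le_trans ?_ (add_le_add_left hs _)
    rw [map_sum, Finset.mul_sum, ← Finset.sum_add_distrib]
    refine Finset.sum_le_sum fun i _ => ?_
    rw [map_smul, smul_eq_mul]
    rcases le_total 0 (a i) with h | h
    · rw [abs_of_nonneg h]
      refine (min_le_right _ _).trans ?_
      nlinarith [mul_le_mul_of_nonneg_left (lo (v i)) h]
    · rw [abs_of_nonpos h]
      refine (min_le_left _ _).trans ?_
      nlinarith [mul_le_mul_of_nonpos_left (up (v i)) h]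
  have hdense : Dense {x : F | DifferentiableAt ℝ (fun z : F => ‖z‖) x} := by
    borelize F
    have := (lipschitzWith_one_norm (E := F)).ae_differentiableAt
      (μ := MeasureTheory.Measure.addHaar)
    exact MeasureTheory.Measure.dense_of_ae this
  set u := ∑ i ∈ s, a i • v i with hu
  refine le_of_forall_pos_le_add fun δ hδ => ?_
  obtain ⟨x, hx, hxd⟩ := hdense.exists_dist_lt u (half_pos hδ)
  have h1 := key x hx
  have h2 : fderiv ℝ (fun z : F => ‖z‖) x x = ‖x‖ := DifferentiableAt.fderiv_norm_self hx
  have h3 : ‖fderiv ℝ (fun z : F => ‖z‖) x‖ ≤ 1 := by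
    simpa using norm_fderiv_le_of_lipschitz ℝ (x₀ := x) (lipschitzWith_one_norm (E := F))
  have h4 : fderiv ℝ (fun z : F => ‖z‖) x (x - u) ≤ ‖x - u‖ := by
    calc _ ≤ ‖fderiv ℝ (fun z : F => ‖z‖) x (x - u)‖ := le_abs_self _
      _ ≤ ‖fderiv ℝ (fun z : F => ‖z‖) x‖ * ‖x - u‖ := ContinuousLinearMap.le_opNorm _ _
      _ ≤ 1 * ‖x - u‖ := by gcongr
      _ = _ := one_mul _
  rw [map_sub, h2] at h4
  rw [dist_eq_norm, norm_sub_rev] at hxd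
  have h5 : ‖u‖ ≤ ‖x‖ + ‖x - u‖ := by
    have := norm_sub_le x (x - u); simpa using this
  linarith

theorem lower_gen {X Y : Type*} [NormedAddCommGroup X] [NormedSpace ℝ X]
    [NormedAddCommGroup Y] [NormedSpace ℝ Y] {ε : ℝ} {f : X → Y} (hf : StdEpsIsom ε f)
    (s : Finset X) (a : X → ℝ) :
    ‖∑ x ∈ s, a x • x‖ ≤ ‖∑ x ∈ s, a x • f x‖ + 3 * ε * ∑ x ∈ s, |a x| := by
  let F := Submodule.span ℝ (s : Set X)
  have hF : FiniteDimensional ℝ F := FiniteDimensional.span_finset ℝ s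
  have hf' : StdEpsIsom ε (fun z : F => f z) :=
    ⟨by simpa using hf.1, fun x y => by simpa using hf.2 x y⟩
  have h := lower_fin hf' s.attach (fun i => a i)
    (fun i => (⟨i, Submodule.subset_span i.2⟩ : F))
  rw [Submodule.coe_norm] at h
  simp only [Submodule.coe_sum, Submodule.coe_smul] at h
  rw [Finset.sum_attach s (fun x => a x • x), Finset.sum_attach s (fun x => a x • f x),
    Finset.sum_attach s (fun x => |a x|)] at h
  exact h

/-- Every λ-injective Banach space is universally `(λ, 4λ)`-left-stable. -/
theorem stmt6 (lam : ℝ) (hlam : 1 ≤ lam)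
    (X : Type u) [NormedAddCommGroup X] [NormedSpace ℝ X] [CompleteSpace X]
    (hX : LambdaInjective lam X) :
    ∀ (Y : Type u) [NormedAddCommGroup Y] [NormedSpace ℝ Y] [CompleteSpace Y],
      ∀ ε : ℝ, 0 < ε → ∀ f : X → Y, StdEpsIsom ε f →
        ∃ T : Lf f →L[ℝ] X, ‖T‖ ≤ lam ∧
          ∀ x : X, ‖T ⟨f x, mem_Lf f x⟩ - x‖ ≤ 4 * lam * ε := by
  intro Y _ _ _ ε hε f hf
  classical
  let δ : X → lp (fun _ : X => ℝ) 1 := fun x => lp.single 1 x (3 * ε)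
  let J : (X →₀ ℝ) →ₗ[ℝ] WithLp 1 (Y × lp (fun _ : X => ℝ) 1) :=
    Finsupp.linearCombination ℝ (fun x => WithLp.toLp 1 (f x, δ x))
  let B : (X →₀ ℝ) →ₗ[ℝ] X := Finsupp.linearCombination ℝ (fun x => x)
  have hδ : ∀ x, ‖δ x‖ ≤ 3 * ε := fun x => by
    have := lp.norm_sum_single (E := fun _ : X => ℝ) (p := 1) (by simp) (fun _ => 3 * ε) {x}
    simp only [Finset.sum_singleton, ENNReal.toReal_one, Real.rpow_one] at this
    rw [this, Real.norm_of_nonneg (by positivity)]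
  have hJ : ∀ a, ‖B a‖ ≤ 1 * ‖J a‖ := by
    intro a
    have h1 : (J a).fst = ∑ x ∈ a.support, a x • f x := by
      simp only [J, Finsupp.linearCombination_apply, Finsupp.sum]
      exact map_sum (WithLp.fstL 1 ℝ Y (lp (fun _ : X => ℝ) 1)) _ _
    have h2 : (J a).snd = ∑ x ∈ a.support, lp.single 1 x (a x * (3 * ε)) := by
      simp only [J, Finsupp.linearCombination_apply, Finsupp.sum]
      refine (map_sum (WithLp.sndL 1 ℝ Y (lp (fun _ : X => ℝ) 1)) _ _).trans ?_
      refine Finset.sum_congr rfl fun x _ => ?_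
      exact (lp.single_smul (E := fun _ : X => ℝ) 1 x (a x) (3 * ε)).symm
    have h3 := lp.norm_sum_single (E := fun _ : X => ℝ) (p := 1) (by simp)
      (fun x => a x * (3 * ε)) a.support
    simp only [ENNReal.toReal_one, Real.rpow_one] at h3
    rw [one_mul, WithLp.prod_norm_eq_of_L1, h1, h2, h3]
    have h4 := lower_gen hf a.support a
    simp only [B, Finsupp.linearCombination_apply, Finsupp.sum]
    refine h4.trans (le_of_eq ?_)
    congr 1
    rw [Finset.mul_sum]
    refine Finset.sum_congr rfl fun x _ => ?_
    rw [norm_mul, Real.norm_eq_abs, Real.norm_of_nonneg (by positivity : 0 ≤ 3 * ε), mul_comm]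
  let W := (LinearMap.range J).topologicalClosure
  have hJW : ∀ a, J a ∈ W := fun a => Submodule.le_topologicalClosure _ ⟨a, rfl⟩
  let J' : (X →₀ ℝ) →ₗ[ℝ] W := J.codRestrict W hJW
  have hd : DenseRange J' := by
    intro w
    rw [closure_subtype]
    have : (Subtype.val '' Set.range J') = (LinearMap.range J : Set _) := by
      ext z; constructor
      · rintro ⟨_, ⟨a, rfl⟩, rfl⟩; exact ⟨a, rfl⟩
      · rintro ⟨a, rfl⟩; exact ⟨_, ⟨a, rfl⟩, rfl⟩
    rw [this]
    exact w.2
  have hJ' : ∀ a, ‖B a‖ ≤ 1 * ‖J' a‖ := hJ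
  obtain ⟨S', hS', hn⟩ := hX _ W (Submodule.isClosed_topologicalClosure _) (B.extendOfNorm J')
  have hn' : ‖S'‖ ≤ lam := by
    refine hn.trans ?_
    have := LinearMap.opNorm_extendOfNorm_le hd zero_le_one hJ'
    nlinarith
  have hS : ∀ a, S' (J a) = B a := fun a =>
    (hS' (J' a)).trans (LinearMap.extendOfNorm_eq hd ⟨1, hJ'⟩ a)
  have hlam0 : 0 ≤ lam := by linarith
  let T0 : Lf f →ₗ[ℝ] X :=
    { toFun := fun y => S' (WithLp.toLp 1 ((y : Y), 0))
      map_add' := fun y z => by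
        rw [← map_add, ← WithLp.toLp_add]; simp
      map_smul' := fun c y => by
        rw [RingHom.id_apply, ← map_smul, ← WithLp.toLp_smul]; simp }
  have hT0 : ∀ y, ‖T0 y‖ ≤ lam * ‖y‖ := by
    intro y
    refine (S'.le_of_opNorm_le hn' _).trans (le_of_eq ?_)
    rw [WithLp.prod_norm_eq_of_L1]; simp
  refine ⟨T0.mkContinuous lam hT0, LinearMap.mkContinuous_norm_le _ hlam0 _, fun x => ?_⟩
  have hx : S' (WithLp.toLp 1 (f x, δ x)) = x := by
    have := hS (Finsupp.single x 1)
    simpa [J, B] using this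
  have hz : T0 ⟨f x, mem_Lf f x⟩ - x = - S' (WithLp.toLp 1 ((0 : Y), δ x)) := by
    have h1 : T0 ⟨f x, mem_Lf f x⟩ = S' (WithLp.toLp 1 (f x, 0)) := rfl
    rw [h1]
    nth_rewrite 2 [← hx]
    rw [← map_sub, ← map_neg, ← WithLp.toLp_sub, ← WithLp.toLp_neg]
    simp
  rw [LinearMap.mkContinuous_apply, hz, norm_neg]
  refine (S'.le_of_opNorm_le hn' _).trans ?_
  rw [WithLp.prod_norm_eq_of_L1]
  have h1 := hδ x
  simp only [WithLp.toLp_fst, WithLp.toLp_snd, norm_zero, zero_add]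
  nlinarith [mul_le_mul_of_nonneg_left h1 hlam0, mul_nonneg hlam0 hε.le]
end
end
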